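/- Fix integers s ≥ 2, n_i > 0, d_i > 0 for 1 ≤ i ≤ s, and write d_i = b_i + c_i with b_i > 0, c_i ≥ 0, and c_j > 0 for some j; set n = n_1 + ⋯ + n_s. Let X ⊂ ℙ^r, r = −1 + ∏ C(n_i+d_i, n_i), be the Segre–Veronese embedding of ℙ^{n_1} × ⋯ × ℙ^{n_s} of multidegree (d_1,…,d_s), over an algebraically closed field of arbitrary characteristic. If k is a positive integer with k ≤ min{ −2 − n + ∏ C(n_i+b_i, n_i), ∏ C(n_i+c_i, n_i) }, then σ_k(X) has dimension kn + k − 1 and a general point q ∈ σ_k(X) of X-rank k has a unique decomposition: #S(q,X) = 1. -/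

import Mathlib

noncomputable section

namespace ContactLoci

variable {K : Type*} [Field K] {ι : Type*} [Fintype ι]

/-- Projective space over `K` with homogeneous coordinates indexed by `ι`. -/
abbrev PP (K : Type*) [Field K] (ι : Type*) : Type _ :=
  Projectivization K (ι → K)

/-- The affine cone over a set of projective points. -/
def coneOf (S : Set (PP K ι)) : Set (ι → K) :=
  ⋃ x ∈ S, (x.submodule : Set (ι → K))

/-- The linear span, in the underlying vector space, of the cone over `S`. -/
def vspan (S : Set (PP K ι)) : Submodule K (ι → K) :=
  Submodule.span K (coneOf S)

/-- The projective linear span of a set of projective points. -/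
def projSpan (S : Set (PP K ι)) : Set (PP K ι) :=
  {x | x.submodule ≤ vspan S}

/-- The projective dimension of the linear span of `S` (`-1` for `S = ∅`). -/
def projDim (S : Set (PP K ι)) : ℤ :=
  (Module.finrank K (vspan S) : ℤ) - 1

/-- A set of projective points is non-degenerate if its linear span is everything. -/
def Nondegenerate (S : Set (PP K ι)) : Prop :=
  vspan S = ⊤

/-- The common zero locus in projective space of a set of polynomials. -/
def zeroLocus (S : Set (MvPolynomial ι K)) : Set (PP K ι) :=
  {x | ∀ f ∈ S, ∀ v ∈ x.submodule, MvPolynomial.eval v f = 0}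

/-- Zariski-closed subsets of projective space: common zero loci of sets of
homogeneous polynomials. -/
def IsZClosed (X : Set (PP K ι)) : Prop :=
  ∃ S : Set (MvPolynomial ι K), (∀ f ∈ S, ∃ d : ℕ, f.IsHomogeneous d) ∧ X = zeroLocus S

/-- Zariski closure. -/
def zclosure (S : Set (PP K ι)) : Set (PP K ι) :=
  ⋂₀ {Y | IsZClosed Y ∧ S ⊆ Y}

/-- Irreducibility with respect to the Zariski topology. -/
def IsZIrreducible (S : Set (PP K ι)) : Prop :=
  S.Nonempty ∧ ∀ Y Z : Set (PP K ι), IsZClosed Y → IsZClosed Z → S ⊆ Y ∪ Z → S ⊆ Y ∨ S ⊆ Z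

/-- An integral projective variety: a Zariski-closed irreducible subset. -/
def IsIntegralVariety (X : Set (PP K ι)) : Prop :=
  IsZClosed X ∧ IsZIrreducible X

/-- `C` is an irreducible component of `S`: a maximal irreducible subset of `S`. -/
def IsZIrredComponent (S C : Set (PP K ι)) : Prop :=
  IsZIrreducible C ∧ C ⊆ S ∧ ∀ D : Set (PP K ι), IsZIrreducible D → D ⊆ S → C ⊆ D → C = D

/-- The dimension of a set: the Krull dimension of the poset of irreducible
Zariski-closed subsets of its Zariski closure (`⊥` for the empty set). -/
def zdim (S : Set (PP K ι)) : WithBot ℕ∞ :=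
  Order.krullDim ({Y : Set (PP K ι) // IsZClosed Y ∧ IsZIrreducible Y ∧ Y ⊆ zclosure S})

/-- A property holds at a general point of `X`: it holds away from a proper
Zariski-closed subset. -/
def HoldsGenerically (X : Set (PP K ι)) (P : PP K ι → Prop) : Prop :=
  ∃ Y : Set (PP K ι), IsZClosed Y ∧ ¬X ⊆ Y ∧ ∀ x ∈ X \ Y, P x

/-- Zero locus of multihomogeneous polynomials in a self-product of projective space. -/
def multiZeroLocus {m : ℕ} (S : Set (MvPolynomial (Fin m × ι) K)) :
    Set (Fin m → PP K ι) :=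
  {u | ∀ f ∈ S, ∀ v : Fin m → ι → K, (∀ i, v i ∈ (u i).submodule) →
    MvPolynomial.eval (fun p => v p.1 p.2) f = 0}

/-- Zariski-closed subsets of the `m`-fold self-product of projective space. -/
def IsMultiZClosed {m : ℕ} (T : Set (Fin m → PP K ι)) : Prop :=
  ∃ S : Set (MvPolynomial (Fin m × ι) K),
    (∀ f ∈ S, ∀ i : Fin m, ∃ d : ℕ,
      MvPolynomial.IsWeightedHomogeneous (fun p : Fin m × ι => if p.1 = i then 1 else 0) f d) ∧
    T = multiZeroLocus S

/-- A property holds for a general `m`-tuple of points of `X`. -/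
def HoldsForGeneralTuples (X : Set (PP K ι)) (m : ℕ) (P : (Fin m → PP K ι) → Prop) : Prop :=
  ∃ T : Set (Fin m → PP K ι), IsMultiZClosed T ∧
    (∃ u : Fin m → PP K ι, (∀ i, u i ∈ X) ∧ u ∉ T) ∧
    ∀ u : Fin m → PP K ι, (∀ i, u i ∈ X) → u ∉ T → P u

/-- The homogeneous vanishing ideal of `X` (as a set of homogeneous polynomials). -/
def homogVanishingIdeal (X : Set (PP K ι)) : Set (MvPolynomial ι K) :=
  {f | (∃ d : ℕ, f.IsHomogeneous d) ∧ ∀ x ∈ X, ∀ v ∈ x.submodule, MvPolynomial.eval v f = 0}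

/-- The embedded (projective) tangent space of `X` at `x`. -/
def embTangentSpace (X : Set (PP K ι)) (x : PP K ι) : Set (PP K ι) :=
  {y | ∀ f ∈ homogVanishingIdeal X,
    ∑ i : ι, y.rep i * MvPolynomial.eval x.rep (MvPolynomial.pderiv i f) = 0}

/-- Smooth points of `X`. -/
def IsSmoothPoint (X : Set (PP K ι)) (x : PP K ι) : Prop :=
  x ∈ X ∧ zdim (embTangentSpace X x) = zdim X

/-- `M_A`: the linear span of the tangent spaces of `X` at the points of `A`. -/
def tangentSpan (X A : Set (PP K ι)) : Set (PP K ι) :=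
  projSpan (⋃ a ∈ A, embTangentSpace X a)

/-- The locus of smooth points of `X` at which `M_A` is tangent to `X`. -/
def tangencyLocus (X A : Set (PP K ι)) : Set (PP K ι) :=
  {x | IsSmoothPoint X x ∧ embTangentSpace X x ⊆ tangentSpan X A}

/-- The tangential contact locus of `X` at `A`: the closure of the union of the
irreducible components of the tangency locus meeting `A`. -/
def contactLocus (X A : Set (PP K ι)) : Set (PP K ι) :=
  zclosure (⋃ C ∈ {C : Set (PP K ι) |
    IsZIrredComponent (tangencyLocus X A) C ∧ (C ∩ A).Nonempty}, C)

/-- `X` is weakly `k`-defective: the tangential contact locus at `k` general points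
has positive dimension. -/
def WeaklyDefective (X : Set (PP K ι)) (k : ℕ) : Prop :=
  HoldsForGeneralTuples X k fun u => 0 < zdim (contactLocus X (Set.range u))

/-- The `k`-th secant variety of `X`. -/
def secant (k : ℕ) (X : Set (PP K ι)) : Set (PP K ι) :=
  zclosure {q | ∃ S : Finset (PP K ι), ↑S ⊆ X ∧ S.card = k ∧ q ∈ projSpan (S : Set (PP K ι))}

/-- The `X`-rank of a point. -/
def xrank (X : Set (PP K ι)) (q : PP K ι) : ℕ :=
  sInf {k | ∃ S : Finset (PP K ι), ↑S ⊆ X ∧ S.card = k ∧ q ∈ projSpan (S : Set (PP K ι))}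

/-- `𝒮(q,X)`: the set of minimal `X`-decompositions of `q`. -/
def decompositions (X : Set (PP K ι)) (q : PP K ι) : Set (Finset (PP K ι)) :=
  {S | ↑S ⊆ X ∧ S.card = xrank X q ∧ q ∈ projSpan (S : Set (PP K ι))}

/-- `X` is `k`-identifiable: a general point of `σ_k(X)` has a unique minimal
decomposition. -/
def Identifiable (X : Set (PP K ι)) (k : ℕ) : Prop :=
  HoldsGenerically (secant k X) fun q => ∃! S : Finset (PP K ι), S ∈ decompositions X q

/-- `α` is the `k`-th secant degree of `X`. -/
def HasSecantDegree (X : Set (PP K ι)) (k α : ℕ) : Prop :=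
  HoldsGenerically (secant k X) fun q => (decompositions X q).ncard = α

/-- Projective linear subspaces. -/
def IsProjLinear (L : Set (PP K ι)) : Prop :=
  L = projSpan L

/-- Lines in projective space. -/
def IsLine (L : Set (PP K ι)) : Prop :=
  IsProjLinear L ∧ Module.finrank K (vspan L) = 2

/-- `X` is uniruled by lines: through a general point of `X` there is a line
contained in `X`. -/
def UniruledByLines (X : Set (PP K ι)) : Prop :=
  HoldsGenerically X fun x => ∃ L : Set (PP K ι), IsLine L ∧ x ∈ L ∧ L ⊆ X

/-- The join of two sets in projective space. -/
def join (A B : Set (PP K ι)) : Set (PP K ι) :=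
  zclosure (⋃ a ∈ A, ⋃ b ∈ B, projSpan {a, b})

/-- The linear space `M` is tangent to `X` along `W`. -/
def TangentAlong (M X W : Set (PP K ι)) : Prop :=
  ∀ x ∈ W, IsSmoothPoint X x → embTangentSpace X x ⊆ M

/-- `S` has exactly `m` irreducible components, all of them projective linear
subspaces, and these components are linearly independent. -/
def ComponentsAreIndepLinear (S : Set (PP K ι)) (m : ℕ) : Prop :=
  ∃ C : Fin m → Set (PP K ι), Function.Injective C ∧
    (∀ D : Set (PP K ι), IsZIrredComponent S D ↔ ∃ i, D = C i) ∧
    (∀ i, IsProjLinear (C i)) ∧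
    Module.finrank K (vspan S) = ∑ i, Module.finrank K (vspan (C i))


/-- The Segre variety: the image of `ℙ^{n 1} × ⋯ × ℙ^{n s}` under the Segre
embedding, given by the complete linear system `|O(1,…,1)|`. -/
def segreVariety (K : Type*) [Field K] (s : ℕ) (n : Fin s → ℕ) :
    Set (PP K (∀ i : Fin s, Fin (n i + 1))) :=
  {x | ∃ u : ∀ i : Fin s, Fin (n i + 1) → K,
    x.submodule = Submodule.span K
      ({fun t => ∏ i, u i (t i)} : Set ((∀ i : Fin s, Fin (n i + 1)) → K))}

/-- The projection of `L ⊆ Segre` to the `i`-th factor is a single point, i.e. `L`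
lies in a single fiber of the `i`-th projection. -/
def SegreFactorIsPoint (K : Type*) [Field K] (s : ℕ) (n : Fin s → ℕ) (i : Fin s)
    (L : Set (PP K (∀ j : Fin s, Fin (n j + 1)))) : Prop :=
  ∃ w : Fin (n i + 1) → K, w ≠ 0 ∧ ∀ x ∈ L,
    ∃ u : ∀ j : Fin s, Fin (n j + 1) → K,
      x.submodule = Submodule.span K
        ({fun t => ∏ j, u j (t j)} : Set ((∀ j : Fin s, Fin (n j + 1)) → K)) ∧
      u i ∈ Submodule.span K ({w} : Set (Fin (n i + 1) → K))

/-- Index type for the Segre–Veronese embedding of multidegree `d`: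
multi-indices of degree `d i` in the homogeneous variables of the `i`-th factor. -/
abbrev svIndex (s : ℕ) (n d : Fin s → ℕ) : Type :=
  ∀ i : Fin s, {w : Fin (n i + 1) → Fin (d i + 1) // ∑ j, (w j : ℕ) = d i}

/-- The Segre–Veronese variety of multidegree `d`: the image of
`ℙ^{n 1} × ⋯ × ℙ^{n s}` under the embedding by `|L_1^{d 1} ⊗ ⋯ ⊗ L_s^{d s}|`. -/
def segreVeroneseVariety (K : Type*) [Field K] (s : ℕ) (n d : Fin s → ℕ) :
    Set (PP K (svIndex s n d)) :=
  {x | ∃ u : ∀ i : Fin s, Fin (n i + 1) → K,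
    x.submodule = Submodule.span K
      ({fun t => ∏ i, ∏ j, u i j ^ ((t i).1 j : ℕ)} : Set (svIndex s n d → K))}

/-- The vector of the moments of degree `≤ d` of the one-dimensional Gaussian
distribution with mean `μ` and variance `t`. -/
def gaussMomentVec (K : Type*) [Field K] (d : ℕ) (μ t : K) : Fin (d + 1) → K := fun i =>
  ∑ j ∈ Finset.range ((i : ℕ) / 2 + 1),
    ((Nat.choose (i : ℕ) (2 * j) * Nat.doubleFactorial (2 * j - 1) : ℕ) : K) *
      t ^ j * μ ^ ((i : ℕ) - 2 * j)

/-- The Gaussian moment variety `𝒢_{1,d} ⊆ ℙ^d`. -/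
def gaussianMomentVariety (K : Type*) [Field K] (d : ℕ) : Set (PP K (Fin (d + 1))) :=
  zclosure {x | ∃ μ t : K,
    x.submodule = Submodule.span K ({gaussMomentVec K d μ t} : Set (Fin (d + 1) → K))}

/-- Zariski-closed families of `m`-tuples of coefficient vectors of linear forms. -/
def IsAffineClosedFamily {m : ℕ} (T : Set (Fin m → ι → K)) : Prop :=
  ∃ S : Set (MvPolynomial (Fin m × ι) K),
    T = {h | ∀ f ∈ S, MvPolynomial.eval (fun p => h p.1 p.2) f = 0}

/-- The linear subspace cut out by the `m` linear forms with coefficient vectors `h`. -/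
def linearSlice {m : ℕ} (h : Fin m → ι → K) : Set (PP K ι) :=
  {x | ∀ j : Fin m, ∑ i : ι, h j i * x.rep i = 0}

/-- `x` lies on the hyperplane with coefficient vector `f`. -/
def inHyperplane (f : ι → K) (x : PP K ι) : Prop :=
  ∑ i : ι, f i * x.rep i = 0

/-- `X ⊆ ℙ^r` (of dimension `n`, `r + 1 = card ι`) is very strange: for a general
codimension-`n` linear subspace `M`, some `r - n + 2` points of `X ∩ M` lie in a
hyperplane of `M`, i.e. in a linear subspace of projective dimension `r - n - 1`. -/
def VeryStrange (n : ℕ) (X : Set (PP K ι)) : Prop :=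
  ∃ T : Set (Fin n → ι → K), IsAffineClosedFamily T ∧ (∃ h, h ∉ T) ∧
    ∀ h : Fin n → ι → K, h ∉ T →
      ∃ A : Finset (PP K ι), ↑A ⊆ X ∩ linearSlice h ∧
        A.card = Fintype.card ι + 1 - n ∧
        Module.finrank K (vspan (A : Set (PP K ι))) ≤ Fintype.card ι - 1 - n


section

open MvPolynomial in
lemma exists_eval_ne {K : Type*} [Field K] [Infinite K] {κ : Type*} (f : MvPolynomial κ K)
    (hf : f ≠ 0) : ∃ w : κ → K, eval w f ≠ 0 := by
  by_contra h
  push Not at h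
  exact hf (MvPolynomial.funext (fun w => by simpa using h w))

open MvPolynomial in
lemma eval_aeval {K : Type*} [Field K] {ι κ : Type*} (ψ : ι → MvPolynomial κ K) (w : κ → K)
    (f : MvPolynomial ι K) : eval w (aeval ψ f) = eval (fun t => eval w (ψ t)) f := by
  have : (aeval w : MvPolynomial κ K →ₐ[K] K).comp (aeval ψ) = aeval (fun t => eval w (ψ t)) := by
    ext t; simp [aeval_eq_eval]
  have := DFunLike.congr_fun this f
  simpa [aeval_eq_eval] using this

open MvPolynomial in
lemma chevalley {K : Type*} [Field K] [IsAlgClosed K] {ι κ : Type*} [Finite ι] [Finite κ]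
    (ψ : ι → MvPolynomial κ K) (G : MvPolynomial κ K) (hG : G ≠ 0) :
    ∃ h : MvPolynomial ι K, aeval ψ h ≠ 0 ∧ ∀ v : ι → K,
      (∀ f : MvPolynomial ι K, aeval ψ f = 0 → eval v f = 0) → eval v h ≠ 0 →
      ∃ w : κ → K, (∀ t, eval w (ψ t) = v t) ∧ eval w G ≠ 0 := by
  let φ : MvPolynomial ι K →+* MvPolynomial κ K := (aeval ψ : MvPolynomial ι K →ₐ[K] _).toRingHom
  have hft : φ.FiniteType := by
    algebraize [φ]
    have : IsScalarTower K (MvPolynomial ι K) (MvPolynomial κ K) :=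
      IsScalarTower.of_algebraMap_eq (fun x => by
        change _ = φ _
        simp [φ, algebraMap_eq])
    exact Algebra.FiniteType.of_restrictScalars_finiteType K (MvPolynomial ι K) (MvPolynomial κ K)
  have hfp : φ.FinitePresentation := RingHom.FinitePresentation.of_finiteType.mp hft
  have hc := PrimeSpectrum.isConstructible_comap_image hfp
    (PrimeSpectrum.isConstructible_basicOpen (f := G))
  obtain ⟨S, hS⟩ := PrimeSpectrum.exists_constructibleSetData_iff.mpr hc
  have h0 : PrimeSpectrum.comap φ ⊥ ∈ S.toSet := by
    rw [hS]
    exact ⟨⊥, by simpa using hG, rfl⟩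
  simp only [PrimeSpectrum.ConstructibleSetData.toSet, Set.mem_iUnion] at h0
  obtain ⟨D, hC, hg, hf⟩ := h0
  refine ⟨D.f, ?_, ?_⟩
  · intro h
    apply hf
    simp only [PrimeSpectrum.mem_zeroLocus, Set.singleton_subset_iff]
    exact h
  · intro v hv hvf
    have hpr : (RingHom.ker (eval v : MvPolynomial ι K →+* K)).IsPrime := RingHom.ker_isPrime _
    have hm : (⟨RingHom.ker (eval v), hpr⟩ : PrimeSpectrum (MvPolynomial ι K)) ∈ S.toSet := by
      simp only [PrimeSpectrum.ConstructibleSetData.toSet, Set.mem_iUnion]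
      refine ⟨D, hC, ?_, ?_⟩
      · rintro _ ⟨i, rfl⟩
        apply hv
        have := hg ⟨i, rfl⟩
        exact this
      · simp only [PrimeSpectrum.mem_zeroLocus, Set.singleton_subset_iff]
        exact hvf
    rw [hS] at hm
    obtain ⟨Q, hQG, hQ⟩ := hm
    have hQ' : Q.asIdeal.comap φ = RingHom.ker (eval v) := congrArg PrimeSpectrum.asIdeal hQ
    have hnull := vanishingIdeal_zeroLocus_eq_radical (K := K) Q.asIdeal
    rw [Q.isPrime.radical] at hnull
    have hGQ : G ∉ Q.asIdeal := hQG
    rw [← hnull, mem_vanishingIdeal_iff] at hGQ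
    push Not at hGQ
    obtain ⟨w, hw, hwG⟩ := hGQ
    refine ⟨w, fun t => ?_, by simpa [aeval_eq_eval] using hwG⟩
    have : (X t - C (v t) : MvPolynomial ι K) ∈ Q.asIdeal.comap φ := by
      rw [hQ']; simp [RingHom.mem_ker]
    have h2 := hw _ this
    simpa [φ, aeval_eq_eval, sub_eq_zero] using h2

open MvPolynomial in
lemma eval_option {K : Type*} [Field K] {ι : Type*} (c : K) (v : ι → K)
    (f : MvPolynomial (Option ι) K) :
    eval (fun o : Option ι => o.elim c v) f
      = ((optionEquivLeft K ι f).map (eval v)).eval c := by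
  induction f using MvPolynomial.induction_on with
  | C a => simp [optionEquivLeft_C]
  | add p q hp hq => simp [hp, hq]
  | mul_X p o hp =>
    cases o <;> simp [hp, optionEquivLeft_X_none, optionEquivLeft_X_some]

open MvPolynomial in
lemma aeval_option {K : Type*} [Field K] {ι κ : Type*} (x : MvPolynomial κ K)
    (ψ : ι → MvPolynomial κ K) (f : MvPolynomial (Option ι) K) :
    aeval (fun o : Option ι => o.elim x ψ) f
      = ((optionEquivLeft K ι f).map
        (aeval ψ : MvPolynomial ι K →ₐ[K] MvPolynomial κ K).rangeRestrict.toRingHom).aeval x := by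
  rw [Polynomial.aeval_def, Polynomial.eval₂_map]
  induction f using MvPolynomial.induction_on with
  | C a =>
    rw [optionEquivLeft_C, Polynomial.eval₂_C, aeval_C]
    change _ = aeval ψ (C a)
    rw [aeval_C]
  | add p q hp hq => rw [map_add, map_add, hp, hq, Polynomial.eval₂_add]
  | mul_X p o hp =>
    rw [map_mul, map_mul, hp, Polynomial.eval₂_mul, aeval_X]
    cases o
    · rw [optionEquivLeft_X_none, Polynomial.eval₂_X]; rfl
    · rw [optionEquivLeft_X_some, Polynomial.eval₂_C]
      congr 1
      change _ = aeval ψ (X _)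
      rw [aeval_X]; rfl

open MvPolynomial in
lemma algebraic_of_finite_fibers {K : Type*} [Field K] [IsAlgClosed K] {ι κ : Type*}
    [Finite ι] [Finite κ]
    (ψ : ι → MvPolynomial κ K) (G : MvPolynomial κ K) (hG : G ≠ 0)
    (hfin : ∀ w0 : κ → K, eval w0 G ≠ 0 →
      {w : κ → K | eval w G ≠ 0 ∧ ∀ t, eval w (ψ t) = eval w0 (ψ t)}.Finite) (j : κ) :
    IsAlgebraic (aeval ψ : MvPolynomial ι K →ₐ[K] MvPolynomial κ K).range
      (X j : MvPolynomial κ K) := by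
  by_contra htr
  have htr : Transcendental (aeval ψ : MvPolynomial ι K →ₐ[K] MvPolynomial κ K).range
      (X j : MvPolynomial κ K) := htr
  rw [transcendental_iff] at htr
  obtain ⟨h, hh, hchev⟩ := chevalley (fun o : Option ι => o.elim (X j) ψ) G hG
  rw [aeval_option] at hh
  have : ∃ i, aeval ψ ((optionEquivLeft K ι h).coeff i) ≠ 0 := by
    by_contra hcon
    push Not at hcon
    apply hh
    have : (optionEquivLeft K ι h).map
      (aeval ψ : MvPolynomial ι K →ₐ[K] MvPolynomial κ K).rangeRestrict.toRingHom = 0 := by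
      ext1 i
      rw [Polynomial.coeff_map, Polynomial.coeff_zero]
      exact Subtype.ext (hcon i)
    rw [this, map_zero]
  obtain ⟨i, hi⟩ := this
  obtain ⟨w0, hw0⟩ := exists_eval_ne _ (mul_ne_zero hG hi)
  rw [map_mul] at hw0
  have hw1 := left_ne_zero_of_mul hw0
  have hw2 := right_ne_zero_of_mul hw0
  rw [eval_aeval] at hw2
  set v : ι → K := fun t => eval w0 (ψ t) with hv
  set P : Polynomial K := (optionEquivLeft K ι h).map (eval v) with hP
  have hP0 : P ≠ 0 := by
    intro h0
    apply hw2
    have := congrArg (fun q => Polynomial.coeff q i) h0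
    simpa [hP] using this
  have hinf : {c : K | P.eval c ≠ 0}.Infinite := by
    have := (Polynomial.finite_setOfPred_isRoot hP0).infinite_compl
    exact this
  have hker : ∀ c : K, ∀ f : MvPolynomial (Option ι) K,
      aeval (fun o : Option ι => o.elim (X j) ψ) f = 0 →
      eval (fun o : Option ι => o.elim c v) f = 0 := by
    intro c f hf
    rw [aeval_option] at hf
    have h0 := htr _ hf
    rw [eval_option]
    have : (optionEquivLeft K ι f).map (eval v) = 0 := by
      ext i
      have h1 := congrArg (fun q => ((Polynomial.coeff q i : (aeval ψ : MvPolynomial ι K →ₐ[K] MvPolynomial κ K).range) : MvPolynomial κ K)) h0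
      simp only [Polynomial.coeff_map, Polynomial.coeff_zero] at h1
      change aeval ψ _ = 0 at h1
      have h2 := congrArg (eval w0) h1
      rw [eval_aeval] at h2
      simpa using h2
    rw [this]; simp
  have hex : ∀ c : K, P.eval c ≠ 0 → ∃ w ∈ {w : κ → K | eval w G ≠ 0 ∧ ∀ t, eval w (ψ t) = eval w0 (ψ t)},
      w j = c := by
    intro c hc
    obtain ⟨w, hw, hwG⟩ := hchev (fun o => o.elim c v) (hker c) (by rw [eval_option]; exact hc)
    refine ⟨w, ⟨hwG, fun t => hw (some t)⟩, by simpa using hw none⟩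
  apply hinf
  refine ((hfin w0 hw1).image (fun w => w j)).subset ?_
  intro c hc
  obtain ⟨w, hw, hwc⟩ := hex c hc
  exact ⟨w, hw, hwc⟩

end

section
open MvPolynomial in
def rk {K : Type*} [Field K] {ι : Type*} (I : Ideal (MvPolynomial ι K)) : ℕ :=
  Cardinal.toNat (Algebra.trdeg K (MvPolynomial ι K ⧸ I))

lemma trdeg_lt {K : Type*} [Field K] {ι : Type*} [Finite ι] (I : Ideal (MvPolynomial ι K)) [I.IsPrime] :
    Algebra.trdeg K (MvPolynomial ι K ⧸ I) < Cardinal.aleph0 :=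
  trdeg_lt_aleph0_of_finiteType

open MvPolynomial in
lemma rk_lt {K : Type*} [Field K] {ι : Type*} [Finite ι] (I J : Ideal (MvPolynomial ι K))
    [I.IsPrime] [J.IsPrime] (h : I < J) : rk J < rk I := by
  have hI := trdeg_lt I
  have hJ := trdeg_lt J
  rw [rk, rk, ← Nat.cast_lt (α := Cardinal), Cardinal.cast_toNat_of_lt_aleph0 hJ,
    Cardinal.cast_toNat_of_lt_aleph0 hI]
  by_contra hcon
  rw [not_lt] at hcon
  let f : (MvPolynomial ι K ⧸ I) →ₐ[K] (MvPolynomial ι K ⧸ J) := Ideal.Quotient.factorₐ K h.le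
  obtain ⟨s, hs⟩ := exists_isTranscendenceBasis K (MvPolynomial ι K ⧸ J)
  have hsurj : Function.Surjective f := Ideal.Quotient.factor_surjective h.le
  choose g hg using hsurj
  let y : s → (MvPolynomial ι K ⧸ I) := fun x => g x
  have hfy : f ∘ y = Subtype.val := by ext x; exact hg _
  have hy : AlgebraicIndependent K y := AlgebraicIndependent.of_comp f (by rw [hfy]; exact hs.1)
  have hyb : IsTranscendenceBasis K y := hy.isTranscendenceBasis_of_trdeg_le hI
    (hcon.trans hs.cardinalMk_eq_trdeg.symm.le)
  obtain ⟨a, haJ, haI⟩ := Set.exists_of_ssubset h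
  have halg := hyb.isAlgebraic.isAlgebraic (Ideal.Quotient.mk I a)
  have hane : (Ideal.Quotient.mk I a) ≠ 0 := by
    rwa [Ne, Ideal.Quotient.eq_zero_iff_mem]
  obtain ⟨r, hr, e, hre⟩ := halg.exists_nonzero_dvd (mem_nonZeroDivisors_of_ne_zero hane)
  have hfr : f (r : MvPolynomial ι K ⧸ I) = 0 := by
    change (r : MvPolynomial ι K ⧸ I) = _ at hre
    rw [hre, map_mul]
    have : f (Ideal.Quotient.mk I a) = Ideal.Quotient.mk J a := rfl
    rw [this, Ideal.Quotient.eq_zero_iff_mem.mpr haJ, zero_mul]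
  have hrm : (r : MvPolynomial ι K ⧸ I) ∈ (aeval y : MvPolynomial s K →ₐ[K] _).range := by
    rw [← Algebra.adjoin_range_eq_range_aeval]; exact r.2
  obtain ⟨p, hp⟩ := hrm
  have hp : aeval y p = (r : MvPolynomial ι K ⧸ I) := hp
  rw [← hp, ← AlgHom.comp_apply, comp_aeval] at hfr
  have : p = 0 := hs.1.eq_zero_of_aeval_eq_zero p (by rw [← hfy]; exact hfr)
  apply hr
  ext
  rw [← hp, this]; simp

open MvPolynomial in
lemma rk_ker {K : Type*} [Field K] [IsAlgClosed K] {ι κ : Type*}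
    [Finite ι] [Fintype κ]
    (ψ : ι → MvPolynomial κ K) (G : MvPolynomial κ K) (hG : G ≠ 0)
    (hfin : ∀ w0 : κ → K, eval w0 G ≠ 0 →
      {w : κ → K | eval w G ≠ 0 ∧ ∀ t, eval w (ψ t) = eval w0 (ψ t)}.Finite) :
    rk (RingHom.ker (aeval ψ : MvPolynomial ι K →ₐ[K] MvPolynomial κ K)) = Fintype.card κ := by
  have halg := algebraic_of_finite_fibers ψ G hG hfin
  have hA : Algebra.IsAlgebraic (aeval ψ : MvPolynomial ι K →ₐ[K] MvPolynomial κ K).range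
      (MvPolynomial κ K) := by
    constructor
    intro x
    induction x using MvPolynomial.induction_on with
    | C a =>
      have := isAlgebraic_algebraMap (A := MvPolynomial κ K)
        (algebraMap K (aeval ψ : MvPolynomial ι K →ₐ[K] MvPolynomial κ K).range a)
      exact this
    | add p q hp hq => exact hp.add hq
    | mul_X p j hp => exact hp.mul (halg j)
  have e := Ideal.quotientKerAlgEquivOfSurjective
    (AlgHom.rangeRestrict_surjective (aeval ψ : MvPolynomial ι K →ₐ[K] MvPolynomial κ K))
  have h1 := e.lift_trdeg_eq
  have h2 := lift_trdeg_add_eq K (aeval ψ : MvPolynomial ι K →ₐ[K] MvPolynomial κ K).range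
    (MvPolynomial κ K)
  rw [trdeg_eq_zero (A := MvPolynomial κ K), MvPolynomial.trdeg_of_isDomain] at h2
  have hk : RingHom.ker (aeval ψ : MvPolynomial ι K →ₐ[K] MvPolynomial κ K) = RingHom.ker
    (AlgHom.rangeRestrict (aeval ψ : MvPolynomial ι K →ₐ[K] MvPolynomial κ K)) := by
    ext f
    simp only [RingHom.mem_ker]
    constructor
    · intro h; exact Subtype.ext h
    · intro h; exact congrArg Subtype.val h
  rw [rk, hk]
  have h1' := congrArg Cardinal.toNat h1
  have h2' := congrArg Cardinal.toNat h2
  simp only [Cardinal.toNat_lift, Cardinal.lift_zero, add_zero] at h1' h2'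
  rw [h1', h2']
  simp

lemma rk_le {K : Type*} [Field K] {ι : Type*} [Finite ι] (I J : Ideal (MvPolynomial ι K))
    [I.IsPrime] [J.IsPrime] (h : I ≤ J) : rk J ≤ rk I := by
  rcases h.lt_or_eq with h | h
  · exact (rk_lt _ _ h).le
  · rw [h]

end

section

lemma exists_derivation {K F : Type*} [Field K] [Field F] [Algebra K F] {V κ : Type*} [Finite V]
    [Fintype κ]
    (a : V → F) (hgen : IntermediateField.adjoin K (Set.range a) = ⊤) (S : Finset V)
    (x : κ → F) (hx : AlgebraicIndependent K x) (hcard : S.card < Fintype.card κ) :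
    ∃ D : Derivation K F F, (∀ v ∈ S, D (a v) = 0) ∧ ∃ v, D (a v) ≠ 0 := by
  classical
  by_contra hcon
  push Not at hcon
  let E : IntermediateField K F := IntermediateField.adjoin K (a '' S)
  have hess : Algebra.EssFiniteType K F := by
    rw [← IntermediateField.fg_top_iff, ← hgen]
    exact IntermediateField.fg_adjoin_of_finite (Set.finite_range a)
  have hessE : Algebra.EssFiniteType E F := Algebra.EssFiniteType.of_comp K E F
  have hD : ∀ D : Derivation E F F, D = 0 := by
    intro D
    let D' : Derivation K F F := D.restrictScalars K
    have h0 : ∀ v ∈ S, D' (a v) = 0 := by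
      intro v hv
      have : a v ∈ E := IntermediateField.subset_adjoin K _ ⟨v, hv, rfl⟩
      exact D.map_algebraMap ⟨a v, this⟩
    have h1 := hcon D' h0
    ext y
    have hy : y ∈ IntermediateField.adjoin K (Set.range a) := by rw [hgen]; trivial
    change D' y = 0
    induction hy using IntermediateField.adjoin_induction with
    | mem x hx => obtain ⟨v, rfl⟩ := hx; exact h1 v
    | algebraMap c => exact D'.map_algebraMap c
    | add x y _ _ hx hy => rw [map_add, hx, hy, add_zero]
    | mul x y _ _ hx hy => rw [Derivation.leibniz, hx, hy, smul_zero, smul_zero, add_zero]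
    | inv x _ hx => rw [Derivation.leibniz_inv, hx, smul_zero]
  have hun : Algebra.FormallyUnramified E F := by
    constructor
    have : Subsingleton (Module.Dual F (Ω[F⁄E])) := by
      constructor
      intro f g
      apply (KaehlerDifferential.linearMapEquivDerivation E F).injective
      rw [hD (KaehlerDifferential.linearMapEquivDerivation E F f),
        hD (KaehlerDifferential.linearMapEquivDerivation E F g)]
    exact (Module.subsingleton_dual_iff F).mp this
  have hsep := Algebra.FormallyUnramified.isSeparable E F
  have halg : Algebra.IsAlgebraic E F := inferInstance
  have halg2 : Algebra.IsAlgebraic (Algebra.adjoin K (a '' S)) F :=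
    IntermediateField.isAlgebraic_adjoin_iff_top.mp halg
  have h1 := Algebra.IsAlgebraic.trdeg_le_cardinalMk K (a '' S : Set F)
  have h2 := hx.lift_cardinalMk_le_trdeg
  have h3 : Cardinal.mk (a '' S : Set F) ≤ (S.card : ℕ) := by
    have : (a '' S : Set F) = ((S.image a : Finset F) : Set F) := by simp
    rw [this, Finset.coe_sort_coe, Cardinal.mk_coe_finset]
    exact_mod_cast Finset.card_image_le
  have h4 := h2.trans (Cardinal.lift_le.mpr (h1.trans h3))
  simp at h4
  omega

open MvPolynomial in
lemma principle.{u} {K : Type u} [Field K] {κ Z : Type}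
    (Sg : Set (MvPolynomial (κ ⊕ Z) K))
    (H : ∀ (F : Type u) [Field F] [Algebra K F] (a : κ ⊕ Z → F),
      IntermediateField.adjoin K (Set.range a) = ⊤ →
      AlgebraicIndependent K (fun x => a (Sum.inl x)) → (∀ f ∈ Sg, aeval a f = 0) → False) :
    ∃ G : MvPolynomial κ K, G ≠ 0 ∧ ∀ w : κ → K, eval w G ≠ 0 → ∀ z : Z → K,
      ¬ ∀ f ∈ Sg, eval (Sum.elim w z) f = 0 := by
  let B := MvPolynomial (κ ⊕ Z) K ⧸ Ideal.span Sg
  let f : MvPolynomial κ K →ₐ[K] B := (Ideal.Quotient.mkₐ K (Ideal.span Sg)).comp (rename Sum.inl)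
  by_cases hf : Function.Injective f
  · exfalso
    obtain ⟨Q, hQ, hQf⟩ := Ideal.exists_comap_eq_of_mem_minimalPrimes_of_injective
      (f := f.toRingHom) hf ⊥ (by rw [IsDomain.minimalPrimes_eq_singleton_bot]; rfl)
    let F := FractionRing (B ⧸ Q)
    let g : MvPolynomial (κ ⊕ Z) K →ₐ[K] F :=
      (IsScalarTower.toAlgHom K (B ⧸ Q) F).comp
        ((Ideal.Quotient.mkₐ K Q).comp (Ideal.Quotient.mkₐ K (Ideal.span Sg)))
    have hg : g = aeval (fun v => g (X v)) := by ext v; simp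
    refine H F (fun v => g (X v)) ?_ ?_ ?_
    · rw [eq_top_iff]
      intro y _
      obtain ⟨p, q, hq, hpq⟩ := IsFractionRing.div_surjective (B ⧸ Q) (y : F)
      rw [← hpq]
      have this : ∀ p : B ⧸ Q, (IsScalarTower.toAlgHom K (B ⧸ Q) F) p ∈
          IntermediateField.adjoin K (Set.range (fun v => g (X v))) := by
        intro p
        obtain ⟨p, rfl⟩ := Ideal.Quotient.mk_surjective p
        obtain ⟨p, rfl⟩ := Ideal.Quotient.mk_surjective p
        change g p ∈ _
        rw [hg]
        apply IntermediateField.algebra_adjoin_le_adjoin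
        rw [Algebra.adjoin_range_eq_range_aeval]
        simp only [aeval_X]
        exact ⟨p, rfl⟩
      exact div_mem (this p) (this q)
    · rw [algebraicIndependent_iff_injective_aeval, injective_iff_map_eq_zero]
      intro p hp
      have : aeval (fun x => g (X (Sum.inl x))) p = g (rename Sum.inl p) := by
        conv_rhs => rw [hg]
        rw [aeval_rename]; rfl
      rw [this] at hp
      have h1 := IsFractionRing.injective (B ⧸ Q) F (hp.trans (map_zero _).symm)
      have h2 : f p ∈ Q := Ideal.Quotient.eq_zero_iff_mem.mp h1
      have h3 : p ∈ Q.comap f.toRingHom := h2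
      rw [hQf] at h3
      exact h3
    · intro h hh
      rw [← hg]
      have : Ideal.Quotient.mkₐ K (Ideal.span Sg) h = 0 :=
        Ideal.Quotient.eq_zero_iff_mem.mpr (Ideal.subset_span hh)
      simp only [g, AlgHom.comp_apply, this, map_zero]
  · rw [injective_iff_map_eq_zero] at hf
    push Not at hf
    obtain ⟨G, hG, hG0⟩ := hf
    refine ⟨G, hG0, fun w hw z hz => hw ?_⟩
    have h1 : rename Sum.inl G ∈ Ideal.span Sg := Ideal.Quotient.eq_zero_iff_mem.mp hG
    have h2 : Ideal.span Sg ≤ RingHom.ker (eval (Sum.elim w z) : MvPolynomial (κ ⊕ Z) K →+* K) :=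
      Ideal.span_le.mpr hz
    have h3 := h2 h1
    rw [RingHom.mem_ker, eval_rename] at h3
    exact h3

end

section
open MvPolynomial

lemma generic_indep.{u} {K : Type u} [Field K] {κ W T : Type} [Fintype W] [Finite T]
    (M : W → T → MvPolynomial κ K) (w0 : κ → K)
    (h : LinearIndependent K (fun i t => eval w0 (M i t))) :
    ∃ Δ : MvPolynomial κ K, Δ ≠ 0 ∧ ∀ (F : Type u) [Field F] [Algebra K F] (a : κ → F),
      aeval a Δ ≠ 0 → LinearIndependent F (fun i t => aeval a (M i t)) := by
  classical
  have := Fintype.ofFinite T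
  let M0 : Matrix W T K := fun i t => eval w0 (M i t)
  obtain ⟨R, hR⟩ : ∃ R : Matrix T W K, M0 * R = 1 := by
    have hinj := h.fintypeLinearCombination_injective
    obtain ⟨g, hg⟩ := LinearMap.exists_leftInverse_of_injective
      (Fintype.linearCombination K (fun i t => eval w0 (M i t))) (LinearMap.ker_eq_bot.mpr hinj)
    refine ⟨(LinearMap.toMatrix' g).transpose, ?_⟩
    ext i j
    have h1 := LinearMap.congr_fun hg (Pi.single i 1)
    have h2 := congrFun h1 j
    simp only [LinearMap.comp_apply, LinearMap.id_apply] at h2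
    rw [Fintype.linearCombination_apply_single, one_smul] at h2
    rw [Matrix.mul_apply, Matrix.one_apply]
    have h3 : g (M0 i) j = ∑ t, M0 i t * (LinearMap.toMatrix' g).transpose t j := by
      rw [← LinearMap.toMatrix'_mulVec g (M0 i)]
      simp only [Matrix.mulVec, dotProduct, Matrix.transpose_apply]
      exact Finset.sum_congr rfl (fun _ _ => mul_comm _ _)
    rw [← h3]
    refine h2.trans ?_
    rw [Pi.single_apply]
    simp only [eq_comm]
  let Mp : Matrix W T (MvPolynomial κ K) := fun i t => M i t
  let Q : Matrix W W (MvPolynomial κ K) := Mp * R.map (C : K →+* MvPolynomial κ K)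
  have hQ : Q = Mp * R.map (C : K →+* MvPolynomial κ K) := rfl
  refine ⟨Matrix.det Q, ?_, ?_⟩
  · intro h0
    have h1 := congrArg (eval w0) h0
    rw [RingHom.map_det, RingHom.mapMatrix_apply, hQ, Matrix.map_mul, Matrix.map_map] at h1
    have e1 : Mp.map (eval w0) = M0 := rfl
    have e2 : R.map ((eval w0 : MvPolynomial κ K →+* K) ∘ C) = R := by ext; simp
    rw [e1, e2, hR] at h1
    simp at h1
  · intro F _ _ a ha
    rw [Fintype.linearIndependent_iff]
    intro c hc
    have h1 : (aeval a (Matrix.det Q) : F) = (Mp.map (aeval a) * R.map (algebraMap K F)).det := by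
      rw [AlgHom.map_det, AlgHom.mapMatrix_apply, hQ, Matrix.map_mul, Matrix.map_map]
      congr 2
      ext; simp
    rw [h1] at ha
    have h2 : Matrix.vecMul c (Mp.map (aeval a) * R.map (algebraMap K F)) = 0 := by
      rw [← Matrix.vecMul_vecMul]
      have : Matrix.vecMul c (Mp.map (aeval a)) = 0 := by
        ext t
        have := congrFun hc t
        simpa [Matrix.vecMul, dotProduct] using this
      rw [this, Matrix.zero_vecMul]
    have h3 := Matrix.eq_zero_of_vecMul_eq_zero ha h2
    exact fun i => congrFun h3 i

lemma extend_indep {K V W : Type*} [Field K] [AddCommGroup V] [Module K V] [FiniteDimensional K V]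
    [Fintype W] (S : Set V) (hS : Submodule.span K S = ⊤) (v0 : W → V) (B : Set W)
    (hB : LinearIndepOn K v0 B) (hc : Fintype.card W ≤ Module.finrank K V) :
    ∃ v : W → V, (∀ i ∈ B, v i = v0 i) ∧ (∀ i ∉ B, v i ∈ S) ∧ LinearIndependent K v := by
  classical
  suffices H : ∀ J : Finset W, ∃ v : W → V, (∀ i ∈ B, v i = v0 i) ∧ (∀ i ∈ J, i ∉ B → v i ∈ S) ∧
      LinearIndepOn K v (B ∪ J) by
    obtain ⟨v, h1, h2, h3⟩ := H Finset.univ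
    refine ⟨v, h1, fun i hi => h2 i (Finset.mem_univ _) hi, ?_⟩
    rw [Finset.coe_univ, Set.union_univ] at h3
    exact linearIndepOn_univ_iff.mp h3
  intro J
  induction J using Finset.induction_on with
  | empty => exact ⟨v0, fun _ _ => rfl, by simp, by simpa using hB⟩
  | insert j J hj ih =>
    obtain ⟨v, h1, h2, h3⟩ := ih
    by_cases hjB : j ∈ B
    · refine ⟨v, h1, ?_, ?_⟩
      · intro i hi hiB
        rcases Finset.mem_insert.mp hi with rfl | hi
        · exact absurd hjB hiB
        · exact h2 i hi hiB
      · have : B ∪ (insert j J : Finset W) = B ∪ J := by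
          ext i; simp only [Finset.coe_insert, Set.mem_union, Set.mem_insert_iff]
          constructor
          · rintro (h | rfl | h)
            · exact Or.inl h
            · exact Or.inl hjB
            · exact Or.inr h
          · rintro (h | h)
            · exact Or.inl h
            · exact Or.inr (Or.inr h)
        rw [this]; exact h3
    · have hjn : j ∉ B ∪ (J : Set W) := by simp [hjB, hj]
      obtain ⟨y, hyS, hy⟩ : ∃ y ∈ S, y ∉ Submodule.span K (v '' (B ∪ J)) := by
        by_contra hcon
        push Not at hcon
        have : Submodule.span K (v '' (B ∪ J)) = ⊤ := by
          rw [eq_top_iff, ← hS]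
          exact Submodule.span_le.mpr hcon
        have hle := finrank_span_finset_le_card (R := K) ((Set.toFinset (B ∪ (J : Set W))).image v)
        rw [Set.finrank] at hle
        rw [Finset.coe_image, Set.coe_toFinset] at hle
        rw [this, finrank_top] at hle
        have h5 := hle.trans Finset.card_image_le
        have h6 : (Set.toFinset (B ∪ (J : Set W))).card < Fintype.card W := by
          apply Finset.card_lt_univ_of_notMem (x := j)
          simpa using hjn
        omega
      have hcong : Set.EqOn v (Function.update v j y) (B ∪ J) := by
        intro i hi
        rw [Function.update_of_ne]
        rintro rfl; exact hjn hi
      refine ⟨Function.update v j y, ?_, ?_, ?_⟩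
      · intro i hi
        rw [← hcong (Or.inl hi)]; exact h1 i hi
      · intro i hi hiB
        rcases Finset.mem_insert.mp hi with rfl | hi
        · simpa using hyS
        · rw [← hcong (Or.inr hi)]; exact h2 i hi hiB
      · rw [Finset.coe_insert, Set.union_insert, linearIndepOn_insert hjn]
        refine ⟨h3.congr hcong, ?_⟩
        rw [← hcong.image_eq]
        simpa using hy

lemma deriv_aeval {K F : Type*} [Field K] [Field F] [Algebra K F] {P : Type*} [Fintype P]
    (D : Derivation K F F) (y : P → F) (f : MvPolynomial P K) :
    D (aeval y f) = ∑ x, aeval y (pderiv x f) * D (y x) := by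
  classical
  induction f using MvPolynomial.induction_on with
  | C a => simp
  | add p q hp hq => simp only [map_add, hp, hq, add_mul, Finset.sum_add_distrib]
  | mul_X p j hp =>
    simp only [map_mul, aeval_X, Derivation.leibniz, hp, smul_eq_mul, map_add, pderiv_X,
      add_mul, Finset.sum_add_distrib, Finset.mul_sum]
    congr 1
    · rw [Finset.sum_eq_single j]
      · simp
      · intro x _ hx; simp [hx.symm]
      · simp
    · exact Finset.sum_congr rfl (fun _ _ => by ring)

end

section
open MvPolynomial

/-- the family of rows -/
def tangRow {K : Type*} [Field K] {P T : Type} {k : ℕ} (f : T → MvPolynomial P K)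
    (j1 j2 : Fin k) (x0 : P) : Fin k ⊕ Option P → T → MvPolynomial (Fin k × P) K
  | Sum.inl j, t => rename (fun x => (j, x)) (f t)
  | Sum.inr (some x), t => rename (fun x => (j1, x)) (pderiv x (f t))
  | Sum.inr none, t => rename (fun x => (j2, x)) (pderiv x0 (f t))

/-- the equations -/
def eqn {K : Type*} [Field K] {P T : Type} {k : ℕ} (f g : T → MvPolynomial P K) (t : T) :
    MvPolynomial ((Fin k × P) ⊕ ((P ⊕ Fin k) ⊕ Bool)) K :=
  rename (fun x => Sum.inr (Sum.inl (Sum.inl x))) (g t) -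
    ∑ j : Fin k, X (Sum.inr (Sum.inl (Sum.inr j))) * rename (fun x => Sum.inl (j, x)) (f t)

lemma G3abs.{u} {K : Type u} [Field K] {P T : Type} [Fintype P] [Finite T] {k : ℕ}
    (f g : T → MvPolynomial P K) (j1 j2 : Fin k) (hj : j1 ≠ j2) (x0 : P)
    (w0 : Fin k × P → K)
    (hw0 : LinearIndependent K (fun i t => eval w0 (tangRow f j1 j2 x0 i t))) :
    ∃ G : MvPolynomial (Fin k × P) K, G ≠ 0 ∧ ∀ w, eval w G ≠ 0 → ∀ (y : P → K) (M : Fin k → K),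
      (∀ t, eval y (g t) = ∑ j, M j * eval (fun x => w (j, x)) (f t)) → M j1 = 0 ∨ M j2 = 0 := by
  classical
  obtain ⟨Δ, hΔ, hind⟩ := generic_indep _ w0 hw0
  let iv : Bool → MvPolynomial ((Fin k × P) ⊕ ((P ⊕ Fin k) ⊕ Bool)) K := fun b =>
    X (Sum.inr (Sum.inl (Sum.inr (if b then j1 else j2)))) * X (Sum.inr (Sum.inr b)) - 1
  obtain ⟨G, hG, hGw⟩ := principle (K := K) (κ := Fin k × P) (Z := (P ⊕ Fin k) ⊕ Bool)
    (Set.range (eqn f g) ∪ Set.range iv) (by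
    intro F _ _ a hgen hai hsol
    let y : P → F := fun x => a (Sum.inr (Sum.inl (Sum.inl x)))
    let M : Fin k → F := fun j => a (Sum.inr (Sum.inl (Sum.inr j)))
    let p : Fin k × P → F := fun q => a (Sum.inl q)
    have hiv : ∀ b : Bool, M (if b then j1 else j2) * a (Sum.inr (Sum.inr b)) = 1 := by
      intro b
      have := hsol (iv b) (Or.inr ⟨b, rfl⟩)
      simp only [iv, map_sub, map_mul, aeval_X, map_one, sub_eq_zero] at this
      exact this
    have hM1 : M j1 ≠ 0 := left_ne_zero_of_mul_eq_one (hiv true)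
    have hM2 : M j2 ≠ 0 := left_ne_zero_of_mul_eq_one (hiv false)
    have hli := hind F p (by
      intro h0
      exact hΔ (hai.eq_zero_of_aeval_eq_zero Δ h0))
    have heq : ∀ t, aeval y (g t) = ∑ j, M j * aeval (fun x => p (j, x)) (f t) := by
      intro t
      have := hsol (eqn f g t) (Or.inl ⟨t, rfl⟩)
      simp only [eqn, map_sub, map_sum, map_mul, aeval_X, sub_eq_zero, aeval_rename] at this
      exact this
    let bad : Finset (Fin k × P) := insert (j2, x0) (Finset.univ.image (fun x => (j1, x)))
    let S : Finset ((Fin k × P) ⊕ ((P ⊕ Fin k) ⊕ Bool)) :=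
      (Finset.univ.image (fun x : P => Sum.inr (Sum.inl (Sum.inl x)))) ∪ (badᶜ.image Sum.inl)
    have hbad : bad.card = Fintype.card P + 1 := by
      rw [Finset.card_insert_of_notMem, Finset.card_image_of_injective]
      · rfl
      · intro x x' h; simpa using h
      · simp [hj]
    have hS : S.card < Fintype.card (Fin k × P) := by
      have h1 : S.card ≤ Fintype.card P + badᶜ.card := by
        refine (Finset.card_union_le _ _).trans (add_le_add ?_ Finset.card_image_le)
        exact Finset.card_image_le
      have h2 := Finset.card_compl_add_card bad
      omega
    obtain ⟨D, hD0, v, hv⟩ := exists_derivation a hgen S _ hai hS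
    have hDy : ∀ x, D (y x) = 0 := fun x => hD0 _ (by simp [S])
    have hDp : ∀ q, q ∉ bad → D (p q) = 0 := fun q hq => hD0 _ (by
      apply Finset.mem_union_right
      exact Finset.mem_image_of_mem _ (Finset.mem_compl.mpr hq))
    let c : Fin k ⊕ Option P → F := fun i => match i with
      | Sum.inl j => D (M j)
      | Sum.inr (some x) => M j1 * D (p (j1, x))
      | Sum.inr none => M j2 * D (p (j2, x0))
    have hc : ∀ i, c i = 0 := by
      rw [Fintype.linearIndependent_iff] at hli
      apply hli c
      ext t
      have h1 := congrArg D (heq t)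
      rw [deriv_aeval, map_sum] at h1
      simp only [hDy, mul_zero, Finset.sum_const_zero, Derivation.leibniz, smul_eq_mul,
        deriv_aeval, Finset.sum_add_distrib] at h1
      rw [Finset.sum_apply, Fintype.sum_sum_type, Fintype.sum_option]
      simp only [Pi.smul_apply, smul_eq_mul, tangRow, aeval_rename, Pi.zero_apply, c]
      have h2 : ∑ j, M j * ∑ x, aeval (fun x => p (j, x)) (pderiv x (f t)) * D (p (j, x))
        = (M j2 * (aeval (fun x => p (j2, x)) (pderiv x0 (f t)) * D (p (j2, x0))))
         + M j1 * ∑ x, aeval (fun x => p (j1, x)) (pderiv x (f t)) * D (p (j1, x)) := by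
        rw [← Finset.sum_subset (Finset.subset_univ {j2, j1}), Finset.sum_pair hj.symm]
        · congr 2
          rw [Finset.sum_eq_single x0]
          · intro x _ hx
            rw [hDp, mul_zero]
            simp [bad, hx, hj]
          · simp
        · intro j _ hjj
          rw [Finset.sum_eq_zero, mul_zero]
          intro x _
          rw [hDp, mul_zero]
          simp only [Finset.mem_insert, Finset.mem_singleton, not_or] at hjj
          simp [bad, hjj.1, Ne.symm hjj.2]
      rw [h2] at h1
      rw [h1, add_comm]
      congr 1
      · rw [Finset.mul_sum]
        congr 1
        · change _ * aeval (fun x => p (j2, x)) _ = _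
          ring
        · refine Finset.sum_congr rfl (fun x _ => ?_)
          change _ * aeval (fun x => p (j1, x)) _ = _
          ring
      · refine Finset.sum_congr rfl (fun j _ => ?_)
        change _ * aeval (fun x => p (j, x)) _ = _
        ring
    have hDM : ∀ j, D (M j) = 0 := fun j => hc (Sum.inl j)
    apply hv
    rcases v with ⟨j, x⟩ | (x | j) | b
    · by_cases hb : (j, x) ∈ bad
      · simp only [bad, Finset.mem_insert, Finset.mem_image, Finset.mem_univ, true_and] at hb
        rcases hb with hb | ⟨x', hb⟩
        · rw [hb]
          exact (mul_eq_zero.mp (hc (Sum.inr none))).resolve_left hM2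
        · rw [← hb]
          exact (mul_eq_zero.mp (hc (Sum.inr (some x')))).resolve_left hM1
      · exact hDp _ hb
    · exact hDy x
    · exact hDM j
    · rw [eq_inv_of_mul_eq_one_right (hiv b), Derivation.leibniz_inv, hDM, smul_zero])
  refine ⟨G, hG, fun w hw y M hM => ?_⟩
  by_contra hcon
  push Not at hcon
  refine hGw w hw (Sum.elim (Sum.elim y M) (fun b => (M (if b then j1 else j2))⁻¹)) ?_
  rintro _ (⟨t, rfl⟩ | ⟨b, rfl⟩)
  · simp only [eqn, map_sub, map_sum, map_mul, eval_X, sub_eq_zero, eval_rename]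
    exact hM t
  · simp only [iv, map_sub, map_mul, eval_X, map_one, sub_eq_zero]
    cases b
    · exact mul_inv_cancel₀ hcon.2
    · exact mul_inv_cancel₀ hcon.1

end

section
open MvPolynomial

lemma span_mono {K : Type*} [Field K] [Infinite K] {P T : Type} [Finite T]
    (α : T → P →₀ ℕ) (hα : Function.Injective α) :
    Submodule.span K (Set.range (fun (y : P → K) (t : T) => eval y (monomial (α t) (1 : K)))) = ⊤ := by
  classical
  have := Fintype.ofFinite T
  by_contra hne
  obtain ⟨φ, hφ, hle⟩ := Submodule.exists_le_ker_of_lt_top _ (lt_top_iff_ne_top.mpr hne)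
  apply hφ
  have hφv : ∀ v : T → K, φ v = ∑ t, φ (Pi.single t 1) * v t := by
    intro v
    conv_lhs => rw [LinearMap.pi_apply_eq_sum_univ φ v]
    refine Finset.sum_congr rfl (fun t _ => ?_)
    rw [smul_eq_mul, mul_comm]
    congr 2
    ext t'
    simp [Pi.single_apply, eq_comm]
  let q : MvPolynomial P K := ∑ t, monomial (α t) (φ (Pi.single t 1))
  have hq : q = 0 := by
    apply MvPolynomial.funext
    intro y
    have h1 : φ (fun t => eval y (monomial (α t) (1 : K))) = 0 :=
      hle (Submodule.subset_span ⟨y, rfl⟩)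
    rw [hφv] at h1
    simp only [q, map_sum, map_zero]
    rw [← h1]
    refine Finset.sum_congr rfl (fun t _ => ?_)
    simp [eval_monomial]
  have hz : ∀ t, φ (Pi.single t 1) = 0 := by
    intro t
    have := congrArg (coeff (α t)) hq
    simp only [q, coeff_sum, coeff_monomial, coeff_zero] at this
    rw [Finset.sum_eq_single t] at this
    · simpa using this
    · intro t' _ ht'
      rw [if_neg]
      exact fun h => ht' (hα h)
    · simp
  apply LinearMap.ext
  intro v
  rw [hφv]
  simp [hz]

lemma exists_indep_points {K : Type*} [Field K] [Infinite K] {P T : Type} [Fintype T]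
    (α : T → P →₀ ℕ) (hα : Function.Injective α) (k : ℕ) (hk : k ≤ Fintype.card T) :
    ∃ w : Fin k × P → K, LinearIndependent K
      (fun (j : Fin k) (t : T) => eval (fun x => w (j, x)) (monomial (α t) (1 : K))) := by
  obtain ⟨v, -, h2, h3⟩ := extend_indep (W := Fin k) _ (span_mono (K := K) α hα) (fun _ => 0) ∅
    (linearIndepOn_empty _ _) (by simpa using hk)
  choose y hy using fun j => h2 j (Set.notMem_empty j)
  refine ⟨fun q => y q.1 q.2, ?_⟩
  have e : (fun (j : Fin k) (t : T) => eval (fun x => y j x) (monomial (α t) (1 : K))) = v := by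
    funext j
    exact hy j
  exact e ▸ h3

open Classical in
lemma eval_zero_mono {K : Type*} [Field K] {P : Type} (s : P →₀ ℕ) (a : K) :
    eval (fun _ => 0) (monomial s a) = if s = 0 then a else 0 := by
  have h : eval (fun _ => (0:K)) (monomial s a) = constantCoeff (monomial s a) := by
    rw [← eval_zero]; rfl
  rw [h, constantCoeff_eq, coeff_monomial]

lemma eval_one_mono {K : Type*} [Field K] {P : Type} (s : P →₀ ℕ) (a : K) :
    eval (fun _ => 1) (monomial s a) = a := by
  simp [eval_monomial, Finsupp.prod]

lemma exists_tang_point {K : Type*} [Field K] [Infinite K] {P T : Type} [Fintype P] [Fintype T]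
    (α : T → P →₀ ℕ) (hα : Function.Injective α) (k : ℕ) (hk : k + Fintype.card P + 1 ≤ Fintype.card T)
    (t0 : T) (ht0 : α t0 = 0) (t1 : P → T) (ht1 : ∀ x, α (t1 x) = Finsupp.single x 1)
    (tA tB : T) (hA : ∀ x, α tA ≠ 0 ∧ α tA - Finsupp.single x 1 ≠ 0)
    (hB : ∀ x, α tB ≠ 0 ∧ α tB - Finsupp.single x 1 ≠ 0)
    (x0 : P) (hx0 : α tB x0 = α tA x0 + 1) (j1 j2 : Fin k) (hj : j1 ≠ j2) :
    ∃ w : Fin k × P → K, LinearIndependent K (fun i t => eval w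
      (tangRow (fun t => monomial (α t) (1 : K)) j1 j2 x0 i t)) := by
  classical
  let f : T → MvPolynomial P K := fun t => monomial (α t) (1 : K)
  let v0 : Fin k ⊕ Option P → T → K := fun i => match i with
    | Sum.inl j => fun t => if j = j1 then eval (fun _ => 0) (f t) else eval (fun _ => 1) (f t)
    | Sum.inr (some x) => fun t => eval (fun _ => 0) (pderiv x (f t))
    | Sum.inr none => fun t => eval (fun _ => 1) (pderiv x0 (f t))
  let B : Set (Fin k ⊕ Option P) := {i | ∀ j, i = Sum.inl j → j = j1 ∨ j = j2}
  have hBi : LinearIndepOn K v0 B := by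
    let e : Option P ⊕ Bool → B := fun i => match i with
      | Sum.inl o => ⟨Sum.inr o, fun j h => by simp at h⟩
      | Sum.inr b => ⟨Sum.inl (if b then j1 else j2), fun j h => by
          cases b <;> simp_all⟩
    have he : Function.Surjective e := by
      rintro ⟨i | i, hi⟩
      · rcases hi i rfl with rfl | rfl
        · exact ⟨Sum.inr true, rfl⟩
        · exact ⟨Sum.inr false, rfl⟩
      · exact ⟨Sum.inl i, rfl⟩
    have hinj : Function.Injective e := by
      rintro (o | b) (o' | b') h
      · simpa [e] using h
      · simp [e] at h
      · simp [e] at h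
      · cases b <;> cases b' <;> simp_all [e, hj.symm]
    rw [LinearIndepOn, ← linearIndependent_equiv (Equiv.ofBijective e ⟨hinj, he⟩),
      Fintype.linearIndependent_iff]
    intro g hg
    have hg' : ∀ t, g (Sum.inl none) * eval (fun _ => 1) (pderiv x0 (f t))
        + ∑ x, g (Sum.inl (some x)) * eval (fun _ => 0) (pderiv x (f t))
        + (g (Sum.inr true) * eval (fun _ => 0) (f t)
          + g (Sum.inr false) * eval (fun _ => 1) (f t)) = 0 := by
      intro t
      have := congrFun hg t
      rw [Finset.sum_apply, Fintype.sum_sum_type, Fintype.sum_option, Fintype.sum_bool] at this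
      have e2 : v0 (Sum.inl j2) t = eval (fun _ => 1) (f t) := if_neg hj.symm
      have e1 : v0 (Sum.inl j1) t = eval (fun _ => 0) (f t) := if_pos rfl
      rw [← e1, ← e2]
      exact this
    simp only [f, pderiv_monomial, eval_zero_mono, eval_one_mono, one_mul] at hg'
    have gA := hg' tA
    have gB := hg' tB
    have g1 := fun x => hg' (t1 x)
    have g0 := hg' t0
    simp only [(hA _).2, if_false, mul_zero, Finset.sum_const_zero] at gA
    simp only [(hB _).2, if_false, mul_zero, Finset.sum_const_zero, hx0] at gB
    rw [if_neg (hA x0).1] at gA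
    rw [if_neg (hB x0).1] at gB
    push_cast at gB
    have hn : g (Sum.inl none) = 0 := by linear_combination gB - gA
    have hf : g (Sum.inr false) = 0 := by rw [hn] at gA; simpa using gA
    have hs : ∀ x, g (Sum.inl (some x)) = 0 := by
      intro x
      have := g1 x
      rw [hn, hf, ht1, if_neg (by simp)] at this
      rw [Finset.sum_eq_single x] at this
      · simpa using this
      · intro y _ hy
        simp [Finsupp.single_apply, hy.symm]
      · simp
    have ht : g (Sum.inr true) = 0 := by
      rw [ht0, hn, hf] at g0
      simpa [hs] using g0
    rintro ((_ | x) | (_ | _))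
    · exact hn
    · exact hs x
    · exact hf
    · exact ht
  obtain ⟨v, h1, h2, h3⟩ := extend_indep (W := Fin k ⊕ Option P) _ (span_mono (K := K) α hα) v0 B
    hBi (by simp; omega)
  have hy : ∀ j : Fin k, ∃ y : P → K, v (Sum.inl j) = fun t => eval y (f t) := by
    intro j
    by_cases hjB : Sum.inl j ∈ B
    · rw [h1 _ hjB]
      by_cases h : j = j1
      · exact ⟨fun _ => 0, by simp [v0, h]⟩
      · exact ⟨fun _ => 1, by simp [v0, h]⟩
    · obtain ⟨y, hy⟩ := h2 _ hjB
      exact ⟨y, hy.symm⟩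
  choose y hy using hy
  let y' : Fin k → P → K := fun j => if j = j1 then fun _ => 0 else if j = j2 then fun _ => 1 else y j
  have hy' : ∀ j, v (Sum.inl j) = fun t => eval (y' j) (f t) := by
    intro j
    by_cases h : j = j1
    · rw [h1]
      · simp [v0, h, y']
      · intro i hi; left; rw [← h]; exact (Sum.inl_injective hi).symm
    by_cases h' : j = j2
    · rw [h1]
      · simp [v0, h', y', hj.symm]
      · intro i hi; right; rw [← h']; exact (Sum.inl_injective hi).symm
    rw [hy j]
    simp [y', h, h']
  refine ⟨fun q => y' q.1 q.2, ?_⟩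
  have e : (fun i t => eval (fun q : Fin k × P => y' q.1 q.2)
      (tangRow (fun t => monomial (α t) (1 : K)) j1 j2 x0 i t)) = v := by
    funext i t
    rcases i with j | (_ | x)
    · rw [hy' j]
      simp only [tangRow, eval_rename]
      rfl
    · rw [h1 _ (by intro j h; simp at h)]
      simp only [tangRow, eval_rename, v0, Function.comp_def, y', hj.symm, if_true, if_false]
      rfl
    · rw [h1 _ (by intro j h; simp at h)]
      simp only [tangRow, eval_rename, v0, Function.comp_def, y', if_true]
      rfl
  rw [e]
  exact h3

end

section
open MvPolynomial

/-- the monomial map -/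
def nu {R : Type*} [CommSemiring R] {s : ℕ} {n : Fin s → ℕ} (e : Fin s → ℕ)
    (u : ∀ i : Fin s, Fin (n i + 1) → R) : svIndex s n e → R :=
  fun t => ∏ i, ∏ j, u i j ^ ((t i).1 j : ℕ)

/-- affine coordinates -/
abbrev PX {s : ℕ} (n : Fin s → ℕ) : Type := Σ i : Fin s, Fin (n i)

/-- chart -/
def hat {R : Type*} [CommSemiring R] {s : ℕ} {n : Fin s → ℕ} (m : ∀ i : Fin s, Fin (n i + 1))
    (y : PX n → R) : ∀ i : Fin s, Fin (n i + 1) → R :=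
  fun i => Fin.insertNth (m i) (1 : R) (fun x => y ⟨i, x⟩)

/-- exponent -/
def expo {s : ℕ} {n e : Fin s → ℕ} (t : svIndex s n e) : PX n →₀ ℕ :=
  Finsupp.equivFunOnFinite.symm (fun x => ((t x.1).1 x.2.succ : ℕ))

lemma expo_apply {s : ℕ} {n e : Fin s → ℕ} (t : svIndex s n e) (x : PX n) :
    expo t x = ((t x.1).1 x.2.succ : ℕ) := rfl

lemma expo_injective {s : ℕ} {n e : Fin s → ℕ} :
    Function.Injective (expo : svIndex s n e → PX n →₀ ℕ) := by
  intro t t' h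
  have h1 : ∀ i l, ((t i).1 (Fin.succ l) : ℕ) = (t' i).1 l.succ := fun i l =>
    DFunLike.congr_fun h (⟨i, l⟩ : PX n)
  funext i
  apply Subtype.ext
  funext j
  apply Fin.ext
  refine Fin.cases ?_ (fun l => h1 i l) j
  have a1 := (t i).2
  have a2 := (t' i).2
  rw [Fin.sum_univ_succ] at a1 a2
  have : ∑ l, ((t i).1 (Fin.succ l) : ℕ) = ∑ l, ((t' i).1 (Fin.succ l) : ℕ) :=
    Finset.sum_congr rfl (fun l _ => h1 i l)
  omega

lemma exists_expo {s : ℕ} {n e : Fin s → ℕ} (β : PX n →₀ ℕ) (hβ : ∀ i, ∑ l, β ⟨i, l⟩ ≤ e i) :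
    ∃ t : svIndex s n e, expo t = β := by
  have hle : ∀ i l, β ⟨i, l⟩ ≤ e i := fun i l =>
    (Finset.single_le_sum (f := fun l => β ⟨i, l⟩) (fun _ _ => Nat.zero_le _) (Finset.mem_univ l)).trans (hβ i)
  refine ⟨fun i => ⟨Fin.cons ⟨e i - ∑ l, β ⟨i, l⟩, by omega⟩
    (fun l => ⟨β ⟨i, l⟩, by have := hle i l; omega⟩), ?_⟩, ?_⟩
  · rw [Fin.sum_univ_succ]
    simp only [Fin.cons_zero, Fin.cons_succ]
    have := hβ i
    omega
  · ext ⟨i, l⟩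
    rw [expo_apply]
    simp only [Fin.cons_succ]

lemma eval_nu {K : Type*} [Field K] {κ : Type*} {s : ℕ} {n : Fin s → ℕ} (e : Fin s → ℕ)
    (u : ∀ i : Fin s, Fin (n i + 1) → MvPolynomial κ K) (t : svIndex s n e) (w : κ → K) :
    eval w (nu e u t) = nu e (fun i j => eval w (u i j)) t := by
  simp [nu, map_prod, map_pow]

lemma eval_hat {K : Type*} [Field K] {κ : Type*} {s : ℕ} {n : Fin s → ℕ}
    (m : ∀ i : Fin s, Fin (n i + 1)) (y : PX n → MvPolynomial κ K) (w : κ → K) :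
    (fun i j => eval w (hat m y i j)) = hat m (fun x => eval w (y x)) := by
  funext i j
  refine Fin.succAboveCases (m i) ?_ (fun l => ?_) j <;> simp [hat]

lemma nu_hat_zero {K : Type*} [Field K] {s : ℕ} {n : Fin s → ℕ} (e : Fin s → ℕ)
    (y : PX n → K) (t : svIndex s n e) :
    nu e (hat 0 y) t = eval y (monomial (expo t) (1 : K)) := by
  rw [eval_monomial, one_mul, Finsupp.prod_fintype _ _ (by simp), Fintype.prod_sigma]
  unfold nu
  refine Finset.prod_congr rfl (fun i _ => ?_)
  rw [Fin.prod_univ_succ]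
  simp [hat, expo_apply]

lemma card_svIndex {s : ℕ} (n e : Fin s → ℕ) :
    Fintype.card (svIndex s n e) = ∏ i, Nat.choose (n i + e i) (n i) := by
  classical
  rw [Fintype.card_pi]
  refine Finset.prod_congr rfl (fun i _ => ?_)
  have h1 : Fintype.card (Sym (Fin (n i + 1)) (e i)) = Nat.choose (n i + e i) (n i) := by
    rw [Sym.card_sym_eq_choose, Fintype.card_fin]
    rw [show n i + 1 + e i - 1 = n i + e i by omega, Nat.choose_symm_add]
  rw [← h1]
  refine Fintype.card_congr (Equiv.trans ?_ (Sym.equivNatSumOfFintype _ _).symm)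
  refine ⟨fun w => ⟨fun j => w.1 j, w.2⟩, fun p => ⟨fun j => ⟨p.1 j, ?_⟩, p.2⟩, fun _ => rfl, fun _ => rfl⟩
  have := Finset.single_le_sum (f := p.1) (fun _ _ => Nat.zero_le _) (Finset.mem_univ j)
  have := p.2
  omega

end

section
open MvPolynomial

lemma rowsum_single {s : ℕ} {n : Fin s → ℕ} (x : PX n) (i : Fin s) (a : ℕ) :
    ∑ l, (Finsupp.single x a : PX n →₀ ℕ) ⟨i, l⟩ = if x.1 = i then a else 0 := by
  classical
  obtain ⟨i', l'⟩ := x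
  by_cases h : i' = i
  · subst h
    rw [Finset.sum_eq_single l']
    · simp
    · intro l _ hl
      rw [Finsupp.single_apply, if_neg]
      intro h
      apply hl
      simpa using h.symm
    · simp
  · rw [if_neg h]
    refine Finset.sum_eq_zero (fun l _ => ?_)
    rw [Finsupp.single_apply, if_neg]
    intro h'
    exact h (congrArg Sigma.fst h')

lemma two_pts {P : Type} (β : P →₀ ℕ) (x y : P) (hxy : x ≠ y) (hx : β x ≠ 0) (hy : β y ≠ 0) (z : P) :
    β ≠ 0 ∧ β - Finsupp.single z 1 ≠ 0 := by
  classical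
  refine ⟨fun h => hx (by simp [h]), fun h => ?_⟩
  by_cases hz : z = x
  · have := DFunLike.congr_fun h y
    rw [Finsupp.tsub_apply, Finsupp.single_eq_of_ne (by rw [hz]; exact hxy.symm)] at this
    exact hy (by simpa using this)
  · have := DFunLike.congr_fun h x
    rw [Finsupp.tsub_apply, Finsupp.single_eq_of_ne (fun h => hz h.symm)] at this
    exact hx (by simpa using this)

lemma exists_AB {s : ℕ} (hs : 2 ≤ s) (n b : Fin s → ℕ) (hn : ∀ i, 0 < n i) (hb : ∀ i, 0 < b i)
    (h5 : 3 + ∑ i, n i ≤ ∏ i, Nat.choose (n i + b i) (n i)) :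
    ∃ (tA tB : svIndex s n b) (x0 : PX n), (∀ x, expo tA ≠ 0 ∧ expo tA - Finsupp.single x 1 ≠ 0) ∧
      (∀ x, expo tB ≠ 0 ∧ expo tB - Finsupp.single x 1 ≠ 0) ∧ expo tB x0 = expo tA x0 + 1 := by
  classical
  let i1 : Fin s := ⟨0, by omega⟩
  let i2 : Fin s := ⟨1, by omega⟩
  have h12 : i1 ≠ i2 := by simp [i1, i2]
  let x : PX n := ⟨i1, ⟨0, hn _⟩⟩
  let y : PX n := ⟨i2, ⟨0, hn _⟩⟩
  have hxy1 : x.1 ≠ y.1 := h12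
  have hpair : ∀ x y : PX n, x.1 ≠ y.1 → ∃ t : svIndex s n b,
      expo t = Finsupp.single x 1 + Finsupp.single y 1 := by
    intro x y hxy
    apply exists_expo
    intro i
    simp only [Finsupp.add_apply, Finset.sum_add_distrib, rowsum_single]
    have := hb i
    split_ifs with h1 h2
    · exact absurd (h1.trans h2.symm) hxy
    all_goals omega
  have htri : ∀ x y : PX n, x.1 ≠ y.1 → 2 ≤ b x.1 → ∃ t : svIndex s n b,
      expo t = Finsupp.single x 2 + Finsupp.single y 1 := by
    intro x y hxy h2
    apply exists_expo
    intro i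
    simp only [Finsupp.add_apply, Finset.sum_add_distrib, rowsum_single]
    have := hb i
    split_ifs with h1 h2
    · exact absurd (h1.trans h2.symm) hxy
    · rw [← h1]; omega
    all_goals omega
  have hgood : ∀ (β : PX n →₀ ℕ) (x y : PX n) (a : ℕ), x.1 ≠ y.1 → a ≠ 0 →
      β = Finsupp.single x a + Finsupp.single y 1 →
      ∀ z, β ≠ 0 ∧ β - Finsupp.single z 1 ≠ 0 := by
    intro β x y a hxy ha h z
    have hne : x ≠ y := fun h => hxy (by rw [h])
    refine two_pts β x y hne ?_ ?_ z
    · rw [h]; simp [ha]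
    · rw [h]; simp
  obtain ⟨tA, hA⟩ := hpair x y hxy1
  have hgA := hgood _ _ _ 1 hxy1 one_ne_zero hA
  have hne : x ≠ y := fun h => hxy1 (by rw [h])
  by_cases hz : ∃ z : PX n, z ≠ x ∧ z ≠ y
  · obtain ⟨z, hzx, hzy⟩ := hz
    by_cases h1 : x.1 = z.1
    · have h2 : y.1 ≠ z.1 := fun h => hxy1 (h1.trans h.symm)
      obtain ⟨tB, hB⟩ := hpair y z h2
      refine ⟨tA, tB, z, hgA, hgood _ _ _ 1 h2 one_ne_zero hB, ?_⟩
      rw [hA, hB]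
      simp [Finsupp.single_apply, hzx.symm, hzy.symm]
    · obtain ⟨tB, hB⟩ := hpair x z h1
      refine ⟨tA, tB, z, hgA, hgood _ _ _ 1 h1 one_ne_zero hB, ?_⟩
      rw [hA, hB]
      simp [Finsupp.single_apply, hzx.symm, hzy.symm]
  · push Not at hz
    by_cases hbx : 2 ≤ b x.1
    · obtain ⟨tB, hB⟩ := htri x y hxy1 hbx
      refine ⟨tA, tB, x, hgA, hgood _ _ _ 2 hxy1 two_ne_zero hB, ?_⟩
      rw [hA, hB]
      simp [Finsupp.single_apply, hne.symm]
    by_cases hby : 2 ≤ b y.1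
    · obtain ⟨tB, hB⟩ := htri y x hxy1.symm hby
      refine ⟨tA, tB, y, hgA, hgood _ _ _ 2 hxy1.symm two_ne_zero hB, ?_⟩
      rw [hA, hB]
      simp [Finsupp.single_apply, hne]
    exfalso
    have hs2 : s = 2 := by
      by_contra hs2
      let z : PX n := ⟨⟨2, by omega⟩, ⟨0, hn _⟩⟩
      have e := hz z (fun h => by simpa [z, x, i1] using congrArg (fun p : PX n => (p.1 : ℕ)) h)
      simpa [z, y, i2] using congrArg (fun p : PX n => (p.1 : ℕ)) e
    have hn1 : ∀ i, n i = 1 := by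
      intro i
      by_contra hni
      have := hn i
      let z : PX n := ⟨i, ⟨1, by omega⟩⟩
      have e := hz z (fun h => by simpa [z, x] using congrArg (fun p : PX n => (p.2 : ℕ)) h)
      simpa [z, y] using congrArg (fun p : PX n => (p.2 : ℕ)) e
    subst hs2
    have b0 : b 0 = 1 := by
      have := hb 0
      have : b x.1 = b 0 := rfl
      omega
    have b1 : b 1 = 1 := by
      have := hb 1
      have : b y.1 = b 1 := rfl
      omega
    rw [Fin.sum_univ_two, Fin.prod_univ_two, b0, b1, hn1, hn1] at h5
    norm_num at h5

end

section
open MvPolynomial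

lemma nu_smul {K : Type*} [Field K] {s : ℕ} {n : Fin s → ℕ} (e : Fin s → ℕ)
    (a : Fin s → K) (u : ∀ i : Fin s, Fin (n i + 1) → K) :
    nu e (fun i => a i • u i) = (∏ i, a i ^ e i) • nu e u := by
  funext t
  simp only [nu, Pi.smul_apply, smul_eq_mul]
  rw [← Finset.prod_mul_distrib]
  refine Finset.prod_congr rfl (fun i _ => ?_)
  simp only [mul_pow]
  rw [Finset.prod_mul_distrib, Finset.prod_pow_eq_pow_sum, (t i).2]

lemma eq_smul_hat {K : Type*} [Field K] {s : ℕ} {n : Fin s → ℕ}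
    (m : ∀ i : Fin s, Fin (n i + 1)) (u : ∀ i : Fin s, Fin (n i + 1) → K)
    (h : ∀ i, u i (m i) ≠ 0) :
    ∃ y : PX n → K, u = fun i => u i (m i) • hat m y i := by
  refine ⟨fun x => (u x.1 (m x.1))⁻¹ * u x.1 ((m x.1).succAbove x.2), ?_⟩
  funext i j
  refine Fin.succAboveCases (m i) ?_ (fun l => ?_) j
  · simp [hat]
  · simp [hat, h i]

lemma nu_ne_zero {K : Type*} [Field K] {s : ℕ} {n : Fin s → ℕ} (e : Fin s → ℕ)
    (u : ∀ i : Fin s, Fin (n i + 1) → K) (hu : ∀ i, u i ≠ 0) : nu e u ≠ 0 := by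
  classical
  choose m hm using fun i => Function.ne_iff.mp (hu i)
  intro h
  have := congrFun h (fun i => ⟨Pi.single (m i) (Fin.last _), by
    rw [Finset.sum_eq_single (m i)]
    · simp
    · intro j _ hj; simp [hj]
    · simp⟩)
  simp only [nu, Pi.zero_apply, Finset.prod_eq_zero_iff, Finset.mem_univ, true_and] at this
  obtain ⟨i, j, h⟩ := this
  by_cases hj : j = m i
  · subst hj
    exact pow_ne_zero _ (hm i) h
  · rw [Pi.single_eq_of_ne hj] at h
    simp at h

lemma nu_prop {K : Type*} [Field K] {s : ℕ} {n : Fin s → ℕ} (e : Fin s → ℕ) (he : ∀ i, 0 < e i)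
    (u : ∀ i : Fin s, Fin (n i + 1) → K) (p : PX n → K) (M : K) (hM : M ≠ 0)
    (h : nu e u = M • nu e (hat 0 p)) : ∃ a : Fin s → K, (∀ i, a i ≠ 0) ∧ u = fun i => a i • hat 0 p i := by
  obtain ⟨t0, ht0⟩ := exists_expo (n := n) (e := e) 0 (by simp)
  have h0 : ∀ i, u i 0 ≠ 0 := by
    intro i hi
    have := congrFun h t0
    rw [Pi.smul_apply, nu_hat_zero, ht0] at this
    simp only [monomial_zero', map_one, smul_eq_mul, mul_one] at this
    apply hM
    rw [← this]
    refine Finset.prod_eq_zero (Finset.mem_univ i) (Finset.prod_eq_zero (Finset.mem_univ 0) ?_)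
    rw [hi, zero_pow]
    have h2 := (t0 i).2
    rw [Fin.sum_univ_succ, Finset.sum_eq_zero] at h2
    · have := he i; omega
    · intro l _
      exact DFunLike.congr_fun ht0 (⟨i, l⟩ : PX n)
  obtain ⟨y, hy⟩ := eq_smul_hat (fun _ => 0) u h0
  refine ⟨fun i => u i 0, h0, ?_⟩
  have hyp : y = p := by
    rw [hy, nu_smul] at h
    have hc := congrFun h t0
    simp only [Pi.smul_apply] at hc
    change _ • nu e (hat 0 y) t0 = _ at hc
    rw [nu_hat_zero, nu_hat_zero, ht0] at hc
    simp only [monomial_zero', map_one, smul_eq_mul, mul_one] at hc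
    rw [hc] at h
    have h' : nu e (hat 0 y) = nu e (hat 0 p) := smul_right_injective _ hM h
    funext x
    obtain ⟨t, ht⟩ := exists_expo (n := n) (e := e) (Finsupp.single x 1) (by
      intro i; rw [rowsum_single]; have := he i; split_ifs <;> omega)
    have := congrFun h' t
    rw [nu_hat_zero, nu_hat_zero, ht] at this
    simpa [eval_monomial] using this
  rw [hyp] at hy
  exact hy

/-- Goodness of a tuple of affine points -/
def GoodP {K : Type*} [Field K] {s : ℕ} {n : Fin s → ℕ} (b c : Fin s → ℕ) {k : ℕ}
    (p : Fin k → PX n → K) : Prop :=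
  LinearIndependent K (fun j => nu c (hat 0 (p j))) ∧
  LinearIndependent K (fun j => nu b (hat 0 (p j))) ∧
  ∀ u : ∀ i : Fin s, Fin (n i + 1) → K, (∀ i, u i ≠ 0) →
    nu b u ∈ Submodule.span K (Set.range (fun j => nu b (hat 0 (p j)))) →
    ∃ j, ∃ a : Fin s → K, (∀ i, a i ≠ 0) ∧ u = fun i => a i • hat 0 (p j) i

lemma indep_poly {K : Type*} [Field K] [Infinite K] {s : ℕ} {n : Fin s → ℕ} (e : Fin s → ℕ) (k : ℕ)
    (hk : k ≤ ∏ i, Nat.choose (n i + e i) (n i)) :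
    ∃ Δ : MvPolynomial (Fin k × PX n) K, Δ ≠ 0 ∧ ∀ w, eval w Δ ≠ 0 →
      LinearIndependent K (fun j => nu e (hat 0 (fun x => w (j, x)))) := by
  rw [← card_svIndex] at hk
  obtain ⟨w0, hw0⟩ := exists_indep_points (K := K) (expo : svIndex s n e → _) expo_injective k hk
  obtain ⟨Δ, hΔ, h⟩ := generic_indep (K := K) (fun (j : Fin k) (t : svIndex s n e) =>
    rename (fun x : PX n => (j, x)) (monomial (expo t) (1 : K))) w0 (by
      simp only [eval_rename]; exact hw0)
  refine ⟨Δ, hΔ, fun w hw => ?_⟩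
  have := h K w (by rwa [aeval_eq_eval])
  have e1 : (fun j => nu e (hat 0 (fun x => w (j, x)))) = fun (j : Fin k) (t : svIndex s n e) =>
      aeval w (rename (fun x : PX n => (j, x)) (monomial (expo t) (1 : K))) := by
    funext j t
    rw [nu_hat_zero, aeval_rename, aeval_eq_eval]
    rfl
  rw [e1]
  exact this

lemma exists_goodP {K : Type*} [Field K] [IsAlgClosed K] {s : ℕ} (hs : 2 ≤ s) (n b c : Fin s → ℕ)
    (hn : ∀ i, 0 < n i) (hb : ∀ i, 0 < b i) (k : ℕ) (hk : 1 ≤ k)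
    (hk1 : k + ∑ i, n i + 2 ≤ ∏ i, Nat.choose (n i + b i) (n i))
    (hk2 : k ≤ ∏ i, Nat.choose (n i + c i) (n i)) :
    ∃ G : MvPolynomial (Fin k × PX n) K, G ≠ 0 ∧ ∀ w, eval w G ≠ 0 →
      GoodP b c (fun j x => w (j, x)) := by
  classical
  have : Infinite K := IsAlgClosed.instInfinite
  obtain ⟨Δc, hΔc, hc⟩ := indep_poly (K := K) c k hk2
  obtain ⟨Δb, hΔb, hbb⟩ := indep_poly (K := K) (n := n) b k (by omega)
  obtain ⟨tA, tB, x0, hA, hB, hx0⟩ := exists_AB hs n b hn hb (by omega)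
  obtain ⟨t0, ht0⟩ := exists_expo (n := n) (e := b) 0 (by simp)
  choose t1 ht1 using fun x => exists_expo (n := n) (e := b) (Finsupp.single x 1) (by
      intro i; rw [rowsum_single]; have := hb i; split_ifs <;> omega)
  have hcard : Fintype.card (PX n) = ∑ i, n i := by simp [PX]
  have key : ∀ (m : ∀ i : Fin s, Fin (n i + 1)) (j1 j2 : Fin k),
      ∃ G : MvPolynomial (Fin k × PX n) K, G ≠ 0 ∧ (j1 ≠ j2 → ∀ w, eval w G ≠ 0 →
        ∀ (y : PX n → K) (M : Fin k → K),
        (∀ t : svIndex s n b, nu b (hat m y) t = ∑ j, M j * nu b (hat 0 (fun x => w (j, x))) t) →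
        M j1 = 0 ∨ M j2 = 0) := by
    intro m j1 j2
    by_cases hj : j1 = j2
    · exact ⟨1, one_ne_zero, fun h => absurd hj h⟩
    obtain ⟨w0, hw0⟩ := exists_tang_point (K := K) (expo : svIndex s n b → _) expo_injective k
      (by rw [card_svIndex, hcard]; omega) t0 ht0 t1 ht1 tA tB hA hB x0 hx0 j1 j2 hj
    obtain ⟨G, hG, h⟩ := G3abs (K := K) (fun t : svIndex s n b => monomial (expo t) (1 : K))
      (fun t => nu b (hat m X) t) j1 j2 hj x0 w0 hw0
    refine ⟨G, hG, fun _ w hw y M hM => h w hw y M (fun t => ?_)⟩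
    rw [eval_nu, eval_hat]
    simp only [eval_X]
    rw [hM t]
    refine Finset.sum_congr rfl (fun j _ => ?_)
    rw [nu_hat_zero]
  choose Gm hGm hG using key
  refine ⟨Δc * Δb * ∏ m, ∏ j1, ∏ j2, Gm m j1 j2, ?_, fun w hw => ?_⟩
  · refine mul_ne_zero (mul_ne_zero hΔc hΔb) ?_
    simp only [Finset.prod_ne_zero_iff]
    exact fun m _ j1 _ j2 _ => hGm m j1 j2
  simp only [map_mul, map_prod] at hw
  have hw3 := right_ne_zero_of_mul hw
  have hw1 := left_ne_zero_of_mul (left_ne_zero_of_mul hw)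
  have hw2 := right_ne_zero_of_mul (left_ne_zero_of_mul hw)
  simp only [Finset.prod_ne_zero_iff] at hw3
  refine ⟨hc w hw1, hbb w hw2, fun u hu hmem => ?_⟩
  choose m hm using fun i => Function.ne_iff.mp (hu i)
  obtain ⟨y, hy⟩ := eq_smul_hat m u hm
  set A : K := ∏ i, (u i (m i)) ^ b i with hAdef
  have hA0 : A ≠ 0 := Finset.prod_ne_zero_iff.mpr (fun i _ => pow_ne_zero _ (hm i))
  have hnu : nu b u = A • nu b (hat m y) := by
    conv_lhs => rw [hy]
    rw [nu_smul]
  obtain ⟨M, hM⟩ := (Submodule.mem_span_range_iff_exists_fun K).mp hmem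
  have hpair : ∀ j1 j2, j1 ≠ j2 → M j1 = 0 ∨ M j2 = 0 := by
    intro j1 j2 hj
    have := hG m j1 j2 hj w (hw3 m (Finset.mem_univ _) j1 (Finset.mem_univ _) j2 (Finset.mem_univ _))
      y (fun j => A⁻¹ * M j) (fun t => by
        have h1 := congrFun hM t
        rw [hnu, Finset.sum_apply] at h1
        simp only [Pi.smul_apply, smul_eq_mul] at h1
        simp only [mul_assoc]
        rw [← Finset.mul_sum, h1, inv_mul_cancel_left₀ hA0])
    simpa [hA0] using this
  have hex : ∃ j, M j ≠ 0 := by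
    by_contra hcon
    push Not at hcon
    apply nu_ne_zero b u hu
    rw [← hM]
    simp [hcon]
  obtain ⟨j, hj⟩ := hex
  refine ⟨j, nu_prop b hb u _ (M j) hj ?_⟩
  rw [← hM]
  rw [Finset.sum_eq_single j]
  · intro j' _ hj'
    rcases hpair j' j hj' with h | h
    · simp [h]
    · exact absurd h hj
  · simp

end

section

lemma nu_mul {K : Type*} [Field K] {s : ℕ} {n d b c : Fin s → ℕ} (hbc : ∀ i, d i = b i + c i)
    (γ : svIndex s n c) :
    ∃ C : (svIndex s n d → K) →ₗ[K] (svIndex s n b → K), ∀ u : ∀ i : Fin s, Fin (n i + 1) → K,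
      C (nu d u) = nu c u γ • nu b u := by
  refine ⟨LinearMap.funLeft K K (fun β i => ⟨fun j => ⟨((β i).1 j : ℕ) + (γ i).1 j, by
    have := hbc i; have := ((β i).1 j).2; have := ((γ i).1 j).2; omega⟩, ?_⟩), fun u => ?_⟩
  · simp only [Finset.sum_add_distrib]
    rw [(β i).2, (γ i).2, hbc]
  · funext β
    simp only [LinearMap.funLeft_apply, nu, Pi.smul_apply, smul_eq_mul, pow_add,
      Finset.prod_mul_distrib]
    rw [mul_comm]

lemma hat_ne_zero {K : Type*} [Field K] {s : ℕ} {n : Fin s → ℕ} (m : ∀ i : Fin s, Fin (n i + 1))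
    (y : PX n → K) (i : Fin s) : hat m y i ≠ 0 := by
  intro h
  have := congrFun h (m i)
  simp [hat] at this

lemma hat_inj {K : Type*} [Field K] {s : ℕ} {n : Fin s → ℕ} (p q : PX n → K) (a : Fin s → K)
    (h : hat 0 p = fun i => a i • hat 0 q i) : p = q := by
  have ha : ∀ i, a i = 1 := by
    intro i
    have := congrFun (congrFun h i) 0
    simpa [hat] using this.symm
  funext ⟨i, l⟩
  have := congrFun (congrFun h i) l.succ
  simpa [hat, ha] using this

lemma cat_core {K : Type*} [Field K] {s : ℕ} {n d b c : Fin s → ℕ}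
    (hbc : ∀ i, d i = b i + c i) {k : ℕ} (p : Fin k → PX n → K) (hp : GoodP b c p)
    (l : Fin k → K) (hl : ∀ j, l j ≠ 0) {Q : Type*} [Fintype Q] (hQ : Fintype.card Q ≤ k)
    (r : Q → ∀ i : Fin s, Fin (n i + 1) → K) (hr : ∀ x i, r x i ≠ 0) (μ : Q → K)
    (h : ∑ x, μ x • nu d (r x) = ∑ j, l j • nu d (hat 0 (p j))) :
    Fintype.card Q = k ∧ (∀ x, ∃ j, ∃ a : Fin s → K, (∀ i, a i ≠ 0) ∧ r x = fun i => a i • hat 0 (p j) i) ∧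
      (∀ j, ∃ x, ∃ a : Fin s → K, (∀ i, a i ≠ 0) ∧ r x = fun i => a i • hat 0 (p j) i) := by
  classical
  obtain ⟨hc, hb, h3⟩ := hp
  set W := Submodule.span K (Set.range (fun x => nu b (r x))) with hW
  set V := Submodule.span K (Set.range (fun j => nu b (hat 0 (p j)))) with hV
  have hVW : V ≤ W := by
    rw [hV, Submodule.span_le]
    rintro _ ⟨j, rfl⟩
    by_contra hj
    obtain ⟨f, hf, hWf⟩ := Submodule.exists_le_ker_of_notMem hj
    have hz : ∑ j, (l j * f (nu b (hat 0 (p j)))) • nu c (hat 0 (p j)) = 0 := by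
      funext γ
      obtain ⟨C, hC⟩ := nu_mul (K := K) hbc γ
      have h1 := congrArg (fun v => f (C v)) h
      simp only [map_sum, map_smul, hC] at h1
      rw [Finset.sum_eq_zero] at h1
      · rw [Finset.sum_apply, Pi.zero_apply]
        rw [h1]
        refine Finset.sum_congr rfl (fun j _ => ?_)
        simp only [Pi.smul_apply, smul_eq_mul]
        ring
      · intro x _
        have : f (nu b (r x)) = 0 := hWf (Submodule.subset_span ⟨x, rfl⟩)
        simp [this]
    have := Fintype.linearIndependent_iff.mp hc _ hz j
    rcases mul_eq_zero.mp this with h | h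
    · exact hl j h
    · exact hf h
  have hVk : Module.finrank K V = k := by
    rw [hV, finrank_span_eq_card hb, Fintype.card_fin]
  have hWQ : Module.finrank K W ≤ Fintype.card Q := finrank_range_le_card _
  have hmono := Submodule.finrank_mono hVW
  have hVW' : V = W := Submodule.eq_of_le_of_finrank_le hVW (by omega)
  have hx : ∀ x, ∃ j, ∃ a : Fin s → K, (∀ i, a i ≠ 0) ∧ r x = fun i => a i • hat 0 (p j) i := by
    intro x
    apply h3 _ (hr x)
    change _ ∈ V
    rw [hVW']
    exact Submodule.subset_span ⟨x, rfl⟩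
  refine ⟨by omega, hx, fun j => ?_⟩
  by_contra hcon
  have hno : nu b (hat 0 (p j)) ∉ Submodule.span K ((fun j => nu b (hat 0 (p j))) '' {j}ᶜ) :=
    hb.notMem_span_image (by simp)
  apply hno
  have hm : nu b (hat 0 (p j)) ∈ W := hVW (Submodule.subset_span ⟨j, rfl⟩)
  revert hm
  apply Submodule.span_le.mpr
  rintro _ ⟨x, rfl⟩
  obtain ⟨j', a, ha, hrx⟩ := hx x
  simp only
  rw [hrx, nu_smul]
  refine Submodule.smul_mem _ _ (Submodule.subset_span ⟨j', ?_, rfl⟩)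
  rintro rfl
  exact hcon ⟨x, a, ha, hrx⟩

lemma nud_indep {K : Type*} [Field K] {s : ℕ} {n d b c : Fin s → ℕ}
    (hbc : ∀ i, d i = b i + c i) {k : ℕ} (p : Fin k → PX n → K) (hp : GoodP b c p) :
    LinearIndependent K (fun j => nu d (hat 0 (p j))) := by
  rw [Fintype.linearIndependent_iff]
  intro g hg j
  have h1 : ∀ β, g j * nu b (hat 0 (p j)) β = 0 := by
    intro β
    refine Fintype.linearIndependent_iff.mp hp.1 (fun j => g j * nu b (hat 0 (p j)) β) ?_ j
    funext γ
    obtain ⟨C, hC⟩ := nu_mul (K := K) hbc γ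
    have := congrFun (congrArg C hg) β
    simp only [map_sum, map_smul, hC, map_zero] at this
    rw [Finset.sum_apply] at this ⊢
    refine Eq.trans ?_ this
    refine Finset.sum_congr rfl (fun j _ => ?_)
    simp only [Pi.smul_apply, smul_eq_mul]
    ring
  obtain ⟨β, hβ⟩ := Function.ne_iff.mp (hp.2.1.ne_zero j)
  exact (mul_eq_zero.mp (h1 β)).resolve_right hβ

/-- point on the variety -/
def pt {K : Type*} [Field K] {s : ℕ} {n : Fin s → ℕ} (d : Fin s → ℕ) (y : PX n → K) :
    PP K (svIndex s n d) :=
  Projectivization.mk K (nu d (hat 0 y)) (nu_ne_zero d _ (hat_ne_zero 0 y))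

lemma pt_submodule {K : Type*} [Field K] {s : ℕ} {n : Fin s → ℕ} (d : Fin s → ℕ) (y : PX n → K) :
    (pt d y).submodule = Submodule.span K {nu d (hat 0 y)} := by
  rw [pt, Projectivization.submodule_mk]

lemma pt_inj {K : Type*} [Field K] {s : ℕ} {n : Fin s → ℕ} (d : Fin s → ℕ) (hd : ∀ i, 0 < d i)
    (y z : PX n → K) (h : pt d y = pt d z) : y = z := by
  have h1 : nu d (hat 0 y) ∈ (pt d z).submodule := by
    rw [← h, pt_submodule]; exact Submodule.mem_span_singleton_self _
  rw [pt_submodule, Submodule.mem_span_singleton] at h1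
  obtain ⟨M, hM⟩ := h1
  have hM0 : M ≠ 0 := by
    rintro rfl
    exact nu_ne_zero d _ (hat_ne_zero 0 y) (by rw [← hM, zero_smul])
  obtain ⟨a, ha, h2⟩ := nu_prop d hd _ z M hM0 hM.symm
  exact hat_inj _ _ _ h2

lemma nu_of_zero {K : Type*} [Field K] {s : ℕ} {n : Fin s → ℕ} (d : Fin s → ℕ) (hd : ∀ i, 0 < d i)
    (u : ∀ i : Fin s, Fin (n i + 1) → K) (hu : nu d u ≠ 0) (i : Fin s) : u i ≠ 0 := by
  intro h
  apply hu
  have e : u = fun i' => (if i' = i then (0:K) else 1) • u i' := by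
    funext i'
    split_ifs with hi
    · subst hi; simp [h]
    · simp
  rw [e, nu_smul, Finset.prod_eq_zero (Finset.mem_univ i), zero_smul]
  simp [(hd i).ne']

/-- the decomposition -/
def decS {K : Type*} [Field K] {s : ℕ} {n : Fin s → ℕ} (d : Fin s → ℕ) {k : ℕ}
    (p : Fin k → PX n → K) : Finset (PP K (svIndex s n d)) := by
  classical exact Finset.univ.image (fun j => pt d (p j))

lemma mem_decS {K : Type*} [Field K] {s : ℕ} {n : Fin s → ℕ} (d : Fin s → ℕ) {k : ℕ}
    (p : Fin k → PX n → K) (x) : x ∈ decS d p ↔ ∃ j, pt d (p j) = x := by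
  classical
  simp [decS]

lemma pt_mem {K : Type*} [Field K] {s : ℕ} {n : Fin s → ℕ} (d : Fin s → ℕ) (y : PX n → K) :
    pt d y ∈ segreVeroneseVariety K s n d := ⟨hat 0 y, pt_submodule d y⟩

lemma decS_sub {K : Type*} [Field K] {s : ℕ} {n : Fin s → ℕ} (d : Fin s → ℕ) {k : ℕ}
    (p : Fin k → PX n → K) : ↑(decS d p) ⊆ segreVeroneseVariety K s n d := by
  intro x hx
  obtain ⟨j, rfl⟩ := (mem_decS d p x).mp hx
  exact pt_mem d _

lemma sub_vspan {K : Type*} [Field K] {ι : Type*} {S : Set (PP K ι)} {x : PP K ι} (hx : x ∈ S) :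
    x.submodule ≤ vspan S := fun _ hv =>
  Submodule.subset_span (Set.mem_biUnion hx hv)

lemma vspan_le {K : Type*} [Field K] {ι : Type*} {S : Set (PP K ι)} {W : Submodule K (ι → K)}
    (h : ∀ x ∈ S, x.submodule ≤ W) : vspan S ≤ W := by
  refine Submodule.span_le.mpr (Set.iUnion₂_subset h)

/-- the parametrization -/
def phi {K : Type*} [Field K] {s : ℕ} {n : Fin s → ℕ} (d : Fin s → ℕ) {k : ℕ} (l : Fin k → K)
    (p : Fin k → PX n → K) : svIndex s n d → K := ∑ j, l j • nu d (hat 0 (p j))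

lemma phi_mem {K : Type*} [Field K] {s : ℕ} {n : Fin s → ℕ} (d : Fin s → ℕ) {k : ℕ} (l : Fin k → K)
    (p : Fin k → PX n → K) : phi d l p ∈ vspan (K := K) (↑(decS d p)) := by
  refine Submodule.sum_mem _ (fun j _ => Submodule.smul_mem _ _ ?_)
  refine sub_vspan (x := pt d (p j)) ((mem_decS d p _).mpr ⟨j, rfl⟩) ?_
  rw [pt_submodule]
  exact Submodule.mem_span_singleton_self _

lemma dec_unique {K : Type*} [Field K] {s : ℕ} {n d b c : Fin s → ℕ} (hd : ∀ i, 0 < d i)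
    (hbc : ∀ i, d i = b i + c i) {k : ℕ} (p : Fin k → PX n → K) (hp : GoodP b c p)
    (l : Fin k → K) (hl : ∀ j, l j ≠ 0) (B : Finset (PP K (svIndex s n d)))
    (hB : ↑B ⊆ segreVeroneseVariety K s n d) (hk : B.card ≤ k)
    (hm : phi d l p ∈ vspan (B : Set (PP K (svIndex s n d)))) : B.card = k ∧ B = decS d p := by
  classical
  choose r hr using fun x : B => hB x.2
  have hr' : ∀ x : B, x.1.submodule = Submodule.span K {nu d (r x)} := hr
  have hne : ∀ x : B, nu d (r x) ≠ 0 := by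
    intro x h0
    have h1 := hr' x
    rw [h0] at h1
    have h2 := Projectivization.finrank_submodule x.1
    rw [h1, Submodule.span_zero_singleton, finrank_bot] at h2
    exact zero_ne_one h2
  have hmem : phi d l p ∈ Submodule.span K (Set.range (fun x : B => nu d (r x))) := by
    revert hm
    apply vspan_le
    intro x hx
    rw [hr' ⟨x, hx⟩]
    exact Submodule.span_mono (by rintro _ rfl; exact ⟨⟨x, hx⟩, rfl⟩)
  obtain ⟨μ, hμ⟩ := (Submodule.mem_span_range_iff_exists_fun K).mp hmem
  obtain ⟨h1, h2, h3⟩ := cat_core hbc p hp l hl (Q := B) (by simpa using hk) r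
    (fun x i => nu_of_zero d hd _ (hne x) i) μ hμ
  have hx : ∀ (x : B) j (a : Fin s → K), (∀ i, a i ≠ 0) → (r x = fun i => a i • hat 0 (p j) i) →
      pt d (p j) = x.1 := by
    intro x j a ha hra
    apply Projectivization.submodule_injective
    rw [pt_submodule, hr', hra, nu_smul]
    exact (Submodule.span_singleton_smul_eq
      (IsUnit.mk0 _ (Finset.prod_ne_zero_iff.mpr (fun i _ => pow_ne_zero _ (ha i)))) _).symm
  refine ⟨by simpa using h1, ?_⟩
  ext x
  rw [mem_decS]
  constructor
  · intro hxB
    obtain ⟨j, a, ha, h⟩ := h2 ⟨x, hxB⟩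
    exact ⟨j, hx _ j a ha h⟩
  · rintro ⟨j, rfl⟩
    obtain ⟨y, a, ha, h⟩ := h3 j
    rw [hx y j a ha h]
    exact y.2

lemma decS_card_le {K : Type*} [Field K] {s : ℕ} {n : Fin s → ℕ} (d : Fin s → ℕ) {k : ℕ}
    (p : Fin k → PX n → K) : (decS d p).card ≤ k := by
  classical
  have : (decS d p).card ≤ (Finset.univ : Finset (Fin k)).card := by
    unfold decS
    exact Finset.card_image_le
  simpa using this

lemma unique_dec {K : Type*} [Field K] {s : ℕ} {n d b c : Fin s → ℕ} (hd : ∀ i, 0 < d i)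
    (hbc : ∀ i, d i = b i + c i) {k : ℕ} (p : Fin k → PX n → K) (hp : GoodP b c p)
    (l : Fin k → K) (hl : ∀ j, l j ≠ 0) (q : PP K (svIndex s n d))
    (hq : q.submodule = Submodule.span K {phi d l p}) :
    ∃! S : Finset (PP K (svIndex s n d)), S ∈ decompositions (segreVeroneseVariety K s n d) q := by
  have hiff : ∀ S : Set (PP K (svIndex s n d)), q ∈ projSpan S ↔ phi d l p ∈ vspan S := by
    intro S
    change q.submodule ≤ _ ↔ _
    rw [hq, Submodule.span_singleton_le_iff_mem]
  obtain ⟨hcard, -⟩ := dec_unique hd hbc p hp l hl _ (decS_sub d p) (decS_card_le d p) (phi_mem d l p)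
  have hrank : xrank (segreVeroneseVariety K s n d) q = k := by
    refine le_antisymm (Nat.sInf_le ⟨decS d p, decS_sub d p, hcard, (hiff _).mpr (phi_mem d l p)⟩) ?_
    refine le_csInf ⟨k, decS d p, decS_sub d p, hcard, (hiff _).mpr (phi_mem d l p)⟩ ?_
    rintro k' ⟨S, hS, rfl, hqS⟩
    by_contra hlt
    have := (dec_unique hd hbc p hp l hl S hS (by omega) ((hiff _).mp hqS)).1
    omega
  refine ⟨decS d p, ⟨decS_sub d p, by rw [hrank, hcard], (hiff _).mpr (phi_mem d l p)⟩, ?_⟩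
  rintro S ⟨hS, hc, hqS⟩
  exact (dec_unique hd hbc p hp l hl S hS (by rw [hc, hrank]) ((hiff _).mp hqS)).2

lemma fiber_finite {K : Type*} [Field K] {s : ℕ} {n d b c : Fin s → ℕ} (hd : ∀ i, 0 < d i)
    (hbc : ∀ i, d i = b i + c i) {k : ℕ} (p : Fin k → PX n → K) (hp : GoodP b c p)
    (l : Fin k → K) (hl : ∀ j, l j ≠ 0) :
    {w : (Fin k → K) × (Fin k → PX n → K) | GoodP b c w.2 ∧ phi d w.1 w.2 = phi d l p}.Finite := by
  classical
  refine Set.Finite.of_injOn (f := Prod.snd) (t := Set.pi Set.univ (fun _ => Set.range p)) ?_ ?_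
    (Set.Finite.pi (fun _ => Set.finite_range p))
  · rintro ⟨l', p'⟩ ⟨hp', he⟩ j -
    have h := (dec_unique hd hbc p hp l hl (decS d p') (decS_sub d p') (decS_card_le d p')
      (by rw [← he]; exact phi_mem d l' p')).2
    have : pt d (p' j) ∈ decS d p := by rw [← h, mem_decS]; exact ⟨j, rfl⟩
    obtain ⟨j', hj'⟩ := (mem_decS d p _).mp this
    exact ⟨j', pt_inj d hd _ _ hj'⟩
  · rintro ⟨l1, p1⟩ ⟨hp1, he1⟩ ⟨l2, p2⟩ ⟨hp2, he2⟩ h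
    simp only at h hp1 hp2 he1 he2
    subst h
    have h0 : ∑ j, (l1 j - l2 j) • nu d (hat 0 (p1 j)) = 0 := by
      simp only [sub_smul, Finset.sum_sub_distrib]
      exact sub_eq_zero.mpr (he1.trans he2.symm)
    have := Fintype.linearIndependent_iff.mp (nud_indep hbc p1 hp1) _ h0
    simp only [Prod.mk.injEq, and_true]
    funext j
    exact sub_eq_zero.mp (this j)

end

section
open MvPolynomial

lemma hom_eval_smul {K ι : Type*} [Field K] {f : MvPolynomial ι K} {d : ℕ} (hf : f.IsHomogeneous d)
    (c : K) (v : ι → K) : eval (c • v) f = c ^ d * eval v f := by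
  rw [eval_eq, eval_eq, Finset.mul_sum]
  refine Finset.sum_congr rfl (fun m hm => ?_)
  have h1 := hf (mem_support_iff.mp hm)
  have h1 : m.degree = d := by
    rw [← h1, Finsupp.degree_eq_weight_one]; rfl
  simp only [Pi.smul_apply, smul_eq_mul, mul_pow, Finset.prod_mul_distrib]
  rw [Finset.prod_pow_eq_pow_sum, ← h1]
  change _ = c ^ (∑ i ∈ m.support, m i) * _
  ring

lemma hc_vanish {K ι : Type*} [Field K] [Infinite K] (f : MvPolynomial ι K) (v : ι → K)
    (h : ∀ t : K, eval (t • v) f = 0) (d : ℕ) : eval v (homogeneousComponent d f) = 0 := by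
  classical
  let P : Polynomial K := ∑ i ∈ Finset.range (f.totalDegree + 1),
    Polynomial.C (eval v (homogeneousComponent i f)) * Polynomial.X ^ i
  have hP : P = 0 := by
    apply Polynomial.funext
    intro t
    rw [Polynomial.eval_zero, ← h t]
    conv_rhs => rw [← sum_homogeneousComponent f]
    simp only [P, Polynomial.eval_finsetSum, map_sum]
    refine Finset.sum_congr rfl (fun i _ => ?_)
    rw [hom_eval_smul (homogeneousComponent_isHomogeneous i f)]
    rw [Polynomial.eval_mul, Polynomial.eval_C, Polynomial.eval_pow, Polynomial.eval_X, mul_comm]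
  by_cases hd : d ≤ f.totalDegree
  · have := congrArg (fun p => Polynomial.coeff p d) hP
    simp only [P, Polynomial.finsetSum_coeff, Polynomial.coeff_C_mul_X_pow, Polynomial.coeff_zero] at this
    rw [Finset.sum_ite_eq (Finset.range (f.totalDegree + 1)) d] at this
    rwa [if_pos (Finset.mem_range.mpr (by omega))] at this
  · rw [homogeneousComponent_eq_zero _ _ (by omega), map_zero]

/-- projective closure of image of a polynomial map -/
def Zpsi {K ι κ : Type*} [Field K] (ψ : ι → MvPolynomial κ K) : Set (PP K ι) :=
  zeroLocus {f | (∃ d, f.IsHomogeneous d) ∧ aeval ψ f = 0}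

lemma Zpsi_closed {K ι κ : Type*} [Field K] (ψ : ι → MvPolynomial κ K) : IsZClosed (Zpsi ψ) :=
  ⟨_, fun _ hf => hf.1, rfl⟩

lemma mem_zeroLocus_span {K ι : Type*} [Field K] {S : Set (MvPolynomial ι K)}
    (hS : ∀ f ∈ S, ∃ d : ℕ, f.IsHomogeneous d) (x : PP K ι) (v : ι → K)
    (hx : x.submodule = Submodule.span K {v}) : x ∈ zeroLocus S ↔ ∀ f ∈ S, eval v f = 0 := by
  constructor
  · intro h f hf
    exact h f hf v (by rw [hx]; exact Submodule.mem_span_singleton_self _)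
  · intro h f hf w hw
    rw [hx, Submodule.mem_span_singleton] at hw
    obtain ⟨c, rfl⟩ := hw
    obtain ⟨d, hd⟩ := hS f hf
    rw [hom_eval_smul hd, h f hf, mul_zero]

lemma exists_pt {K ι : Type*} [Field K] (v : ι → K) (hv : v ≠ 0) :
    ∃ x : PP K ι, x.submodule = Submodule.span K {v} :=
  ⟨Projectivization.mk K v hv, Projectivization.submodule_mk _ _⟩

lemma image_mem_Zpsi {K ι κ : Type*} [Field K] (ψ : ι → MvPolynomial κ K) (w : κ → K) (x : PP K ι)
    (hx : x.submodule = Submodule.span K {fun t => eval w (ψ t)}) : x ∈ Zpsi ψ := by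
  refine (mem_zeroLocus_span (fun f hf => hf.1) x _ hx).mpr (fun f hf => ?_)
  rw [← eval_aeval, hf.2, map_zero]

/-- a generic point of the image -/
lemma exists_image {K ι κ : Type*} [Field K] [Infinite K] (ψ : ι → MvPolynomial κ K)
    (hψ : ∃ t, ψ t ≠ 0) (G : MvPolynomial κ K) (hG : G ≠ 0) :
    ∃ w, eval w G ≠ 0 ∧ ∃ x : PP K ι, x ∈ Zpsi ψ ∧
      x.submodule = Submodule.span K {fun t => eval w (ψ t)} := by
  obtain ⟨t, ht⟩ := hψ
  obtain ⟨w, hw⟩ := exists_eval_ne (G * ψ t) (mul_ne_zero hG ht)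
  rw [map_mul] at hw
  obtain ⟨x, hx⟩ := exists_pt (fun t => eval w (ψ t)) (fun h => right_ne_zero_of_mul hw (congrFun h t))
  exact ⟨w, left_ne_zero_of_mul hw, x, image_mem_Zpsi ψ w x hx, hx⟩

lemma aeval_zero_of_vanish {K ι κ : Type*} [Field K] [Infinite K] (ψ : ι → MvPolynomial κ K)
    (hψ : ∃ t, ψ t ≠ 0) (f : MvPolynomial ι K)
    (h : ∀ x ∈ Zpsi ψ, ∀ v ∈ x.submodule, eval v f = 0) : aeval ψ f = 0 := by
  by_contra hne
  obtain ⟨w, hw, x, hx, hxs⟩ := exists_image ψ hψ _ hne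
  rw [eval_aeval] at hw
  exact hw (h x hx _ (by rw [hxs]; exact Submodule.mem_span_singleton_self _))

lemma Zpsi_irred {K ι κ : Type*} [Field K] [Infinite K] (ψ : ι → MvPolynomial κ K)
    (hψ : ∃ t, ψ t ≠ 0) : IsZIrreducible (Zpsi ψ) := by
  constructor
  · obtain ⟨w, -, x, hx, -⟩ := exists_image ψ hψ 1 one_ne_zero
    exact ⟨x, hx⟩
  · rintro Y Z ⟨S, hS, rfl⟩ ⟨S', hS', rfl⟩ h
    by_contra hcon
    rw [not_or] at hcon
    have key : ∀ S : Set (MvPolynomial ι K), (∀ f ∈ S, ∃ d : ℕ, f.IsHomogeneous d) →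
        ¬ Zpsi ψ ⊆ zeroLocus S → ∃ f ∈ S, aeval ψ f ≠ 0 := by
      intro S hS hn
      by_contra hc
      push Not at hc
      exact hn (fun x hx f hf v hv => hx f ⟨hS f hf, hc f hf⟩ v hv)
    obtain ⟨f, hf, hf0⟩ := key S hS hcon.1
    obtain ⟨g, hg, hg0⟩ := key S' hS' hcon.2
    obtain ⟨w, hw, x, hx, hxs⟩ := exists_image ψ hψ _ (mul_ne_zero hf0 hg0)
    rw [map_mul, eval_aeval, eval_aeval] at hw
    have hm : (fun t => eval w (ψ t)) ∈ x.submodule := by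
      rw [hxs]; exact Submodule.mem_span_singleton_self _
    rcases h hx with h | h
    · exact left_ne_zero_of_mul hw (h f hf _ hm)
    · exact right_ne_zero_of_mul hw (h g hg _ hm)

/-- scalability -/
def Scal {K ι κ : Type*} [Field K] (ψ : ι → MvPolynomial κ K) : Prop :=
  ∀ (c : K) (w : κ → K), ∃ w' : κ → K, ∀ t, eval w' (ψ t) = c * eval w (ψ t)

lemma ker_homog {K ι κ : Type*} [Field K] [Infinite K] (ψ : ι → MvPolynomial κ K) (hs : Scal ψ)
    (f : MvPolynomial ι K) (hf : aeval ψ f = 0) (d : ℕ) : aeval ψ (homogeneousComponent d f) = 0 := by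
  apply MvPolynomial.funext
  intro w
  rw [eval_aeval, map_zero]
  apply hc_vanish
  intro c
  obtain ⟨w', hw'⟩ := hs c w
  have := eval_aeval ψ w' f
  rw [hf, map_zero] at this
  rw [this]
  congr 1
  congr 1
  funext t
  simp [hw']

lemma vanish_of_components {K ι : Type*} [Field K] (f : MvPolynomial ι K) (v : ι → K)
    (h : ∀ d, eval v (homogeneousComponent d f) = 0) : eval v f = 0 := by
  rw [← sum_homogeneousComponent f, map_sum]
  exact Finset.sum_eq_zero (fun d _ => h d)

lemma ker_vanish {K ι κ : Type*} [Field K] [Infinite K] (ψ : ι → MvPolynomial κ K) (hs : Scal ψ)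
    (f : MvPolynomial ι K) (hf : aeval ψ f = 0) (x : PP K ι) (hx : x ∈ Zpsi ψ) (v : ι → K)
    (hv : v ∈ x.submodule) : eval v f = 0 := by
  refine vanish_of_components f v (fun d => ?_)
  exact hx _ ⟨⟨d, homogeneousComponent_isHomogeneous d f⟩, ker_homog ψ hs f hf d⟩ v hv

/-- vanishing ideal -/
def vI {K ι : Type*} [Field K] (Y : Set (PP K ι)) : Ideal (MvPolynomial ι K) where
  carrier := {f | ∀ x ∈ Y, ∀ v ∈ x.submodule, eval v f = 0}
  add_mem' := fun ha hb x hx v hv => by rw [map_add, ha x hx v hv, hb x hx v hv, add_zero]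
  zero_mem' := fun x hx v hv => map_zero _
  smul_mem' := fun c f hf x hx v hv => by rw [smul_eq_mul, map_mul, hf x hx v hv, mul_zero]

lemma mem_vI {K ι : Type*} [Field K] (Y : Set (PP K ι)) (f : MvPolynomial ι K) :
    f ∈ vI Y ↔ ∀ x ∈ Y, ∀ v ∈ x.submodule, eval v f = 0 := Iff.rfl

lemma vI_component {K ι : Type*} [Field K] [Infinite K] (Y : Set (PP K ι)) (f : MvPolynomial ι K)
    (hf : f ∈ vI Y) (d : ℕ) : homogeneousComponent d f ∈ vI Y := fun x hx v hv =>
  hc_vanish f v (fun t => hf x hx _ (Submodule.smul_mem _ t hv)) d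

attribute [local instance] MvPolynomial.gradedAlgebra in
lemma vI_prime {K ι : Type*} [Field K] [Infinite K] (Y : Set (PP K ι)) (hY : IsZIrreducible Y) :
    (vI Y).IsPrime := by
  have hh : (vI Y).IsHomogeneous (homogeneousSubmodule ι K) := by
    intro d f hf
    have := vI_component Y f hf d
    rw [← decomposition.decompose'_apply] at this
    exact this
  refine hh.isPrime_of_homogeneous_mem_or_mem ?_ ?_
  · rw [Ideal.ne_top_iff_one]
    intro h1
    obtain ⟨x, hx⟩ := hY.1
    have := h1 x hx 0 (Submodule.zero_mem _)
    simp at this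
  · rintro f g ⟨df, hf⟩ ⟨dg, hg⟩ hfg
    rw [mem_homogeneousSubmodule] at hf hg
    have hc : ∀ (f : MvPolynomial ι K) (d : ℕ), f.IsHomogeneous d → IsZClosed (zeroLocus {f}) :=
      fun f d hf => ⟨{f}, by rintro _ rfl; exact ⟨d, hf⟩, rfl⟩
    have hm : ∀ f : MvPolynomial ι K, Y ⊆ zeroLocus {f} → f ∈ vI Y :=
      fun f h x hx v hv => h hx f rfl v hv
    refine (hY.2 _ _ (hc f _ hf) (hc g _ hg) ?_).imp (hm f) (hm g)
    intro x hx
    have hxs : x.submodule = Submodule.span K {x.rep} := Projectivization.submodule_eq x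
    have h0 := hfg x hx x.rep (by rw [hxs]; exact Submodule.mem_span_singleton_self _)
    rw [map_mul] at h0
    refine (mul_eq_zero.mp h0).imp (fun h => ?_) (fun h => ?_)
    · exact (mem_zeroLocus_span (by rintro _ rfl; exact ⟨_, hf⟩) x _ hxs).mpr (by rintro _ rfl; exact h)
    · exact (mem_zeroLocus_span (by rintro _ rfl; exact ⟨_, hg⟩) x _ hxs).mpr (by rintro _ rfl; exact h)

lemma vI_lt {K ι : Type*} [Field K] {Y Z : Set (PP K ι)} (hY : IsZClosed Y) (h : Y < Z) :
    vI Z < vI Y := by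
  have hle : vI Z ≤ vI Y := fun f hf x hx => hf x (h.le hx)
  refine lt_of_le_not_ge hle (fun hge => h.not_ge ?_)
  obtain ⟨S, hS, rfl⟩ := hY
  intro x hx f hf
  exact hge (fun x hx v hv => hx f hf v hv : f ∈ vI (zeroLocus S)) x hx

lemma vI_rk_pos {K ι : Type*} [Field K] [Infinite K] [Finite ι] (Y : Set (PP K ι))
    (hY : IsZIrreducible Y) : 1 ≤ rk (vI Y) := by
  have := vI_prime Y hY
  let m : Ideal (MvPolynomial ι K) := RingHom.ker (eval (0 : ι → K))
  have hm : m.IsPrime := RingHom.ker_isPrime _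
  have hlt : vI Y < m := by
    obtain ⟨x, hx⟩ := hY.1
    refine lt_of_le_not_ge (fun f hf => hf x hx 0 (Submodule.zero_mem _)) (fun hge => ?_)
    apply x.rep_nonzero
    funext t
    have : (X t : MvPolynomial ι K) ∈ vI Y := hge (by simp [m, RingHom.mem_ker])
    have h := this x hx x.rep (by
      rw [Projectivization.submodule_eq x]; exact Submodule.mem_span_singleton_self _)
    simpa using h
  have := rk_lt _ _ hlt
  omega

lemma vI_Zpsi_le {K ι κ : Type*} [Field K] [IsAlgClosed K] [Finite ι] (ψ : ι → MvPolynomial κ K)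
    (hs : Scal ψ) (Y : Set (PP K ι)) (hY : IsZIrreducible Y) (hle : Y ⊆ Zpsi ψ) :
    rk (vI Y) ≤ rk (RingHom.ker (aeval ψ : MvPolynomial ι K →ₐ[K] MvPolynomial κ K)) := by
  have : Infinite K := IsAlgClosed.instInfinite
  have := vI_prime Y hY
  have : (RingHom.ker (aeval ψ : MvPolynomial ι K →ₐ[K] MvPolynomial κ K)).IsPrime :=
    RingHom.ker_isPrime _
  exact rk_le _ _ (fun f hf x hx v hv => ker_vanish ψ hs f hf x (hle hx) v hv)

lemma krull_le {K ι κ : Type*} [Field K] [IsAlgClosed K] [Finite ι] (ψ : ι → MvPolynomial κ K)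
    (hs : Scal ψ) (m : ℕ)
    (hrk : rk (RingHom.ker (aeval ψ : MvPolynomial ι K →ₐ[K] MvPolynomial κ K)) = m) :
    Order.krullDim {Y : Set (PP K ι) // IsZClosed Y ∧ IsZIrreducible Y ∧ Y ⊆ Zpsi ψ} ≤
      (((m - 1 : ℕ) : ℕ∞) : WithBot ℕ∞) := by
  have : Infinite K := IsAlgClosed.instInfinite
  refine iSup_le (fun p => ?_)
  have hstep : ∀ i : ℕ, ∀ hi : i < p.length + 1, i + 1 ≤ rk (vI (p ⟨i, hi⟩).1) := by
    intro i
    induction i with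
    | zero => intro hi; exact vI_rk_pos _ (p _).2.2.1
    | succ i ih =>
      intro hi
      have h1 := ih (by omega)
      have hlt : p ⟨i, by omega⟩ < p ⟨i + 1, hi⟩ := p.strictMono (by simp [Fin.lt_def])
      have := vI_prime _ (p ⟨i, by omega⟩).2.2.1
      have := vI_prime _ (p ⟨i + 1, hi⟩).2.2.1
      have := rk_lt _ _ (vI_lt (p _).2.1 hlt)
      omega
  have h1 := hstep p.length (by omega)
  have h2 := vI_Zpsi_le ψ hs _ (p ⟨p.length, by omega⟩).2.2.1 (p ⟨p.length, by omega⟩).2.2.2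
  have : p.length ≤ m - 1 := by omega
  exact_mod_cast this

end

section
open MvPolynomial

open Classical in
/-- extension of coordinates -/
def extw {K τ : Type*} [Field K] (Lm : τ → Prop) (τ0 : τ) (w0 : τ → K) (T : Set τ)
    (h0 : τ0 ∈ T) (w : T → K) (x : τ) : K :=
  if h : x ∈ T then w ⟨x, h⟩ else if Lm x then w ⟨τ0, h0⟩ else w0 x

open Classical in
/-- polynomial version -/
def extp {K τ : Type*} [Field K] (Lm : τ → Prop) (τ0 : τ) (w0 : τ → K) (T : Set τ)
    (h0 : τ0 ∈ T) (x : τ) : MvPolynomial T K :=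
  if h : x ∈ T then X ⟨x, h⟩ else if Lm x then X ⟨τ0, h0⟩ else C (w0 x)

lemma eval_extp {K τ : Type*} [Field K] (Lm : τ → Prop) (τ0 : τ) (w0 : τ → K) (T : Set τ)
    (h0 : τ0 ∈ T) (w : T → K) (f : MvPolynomial τ K) :
    eval w (aeval (extp Lm τ0 w0 T h0) f) = eval (extw Lm τ0 w0 T h0 w) f := by
  rw [eval_aeval]
  congr 2
  funext x
  unfold extp extw
  split_ifs <;> simp

lemma extw_inj {K τ : Type*} [Field K] (Lm : τ → Prop) (τ0 : τ) (w0 : τ → K) (T : Set τ)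
    (h0 : τ0 ∈ T) : Function.Injective (extw Lm τ0 w0 T h0) := by
  intro w w' h
  funext ⟨x, hx⟩
  have := congrFun h x
  simpa [extw, hx] using this

lemma extw_trans {K τ : Type*} [Field K] (Lm : τ → Prop) (τ0 : τ) (w0 : τ → K) (T T' : Set τ)
    (h0 : τ0 ∈ T) (h0' : τ0 ∈ T') (h : T ⊆ T') (w : T → K) :
    extw Lm τ0 w0 T' h0' (fun x => extw Lm τ0 w0 T h0 w x) = extw Lm τ0 w0 T h0 w := by
  funext x
  by_cases hx' : x ∈ T'
  · simp [extw, hx']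
  · have hx : x ∉ T := fun hx => hx' (h hx)
    simp [extw, hx', hx, h0]

lemma krull_ge {K ι τ : Type*} [Field K] [IsAlgClosed K] [Finite ι] [Fintype τ]
    (φ : ι → MvPolynomial τ K) (G : MvPolynomial τ K)
    (hfin : ∀ w0 : τ → K, eval w0 G ≠ 0 →
      {w : τ → K | eval w G ≠ 0 ∧ ∀ t, eval w (φ t) = eval w0 (φ t)}.Finite)
    (Lm : τ → Prop) (τ0 : τ) (hτ0 : Lm τ0) (w0 : τ → K) (hw0 : ∀ x, Lm x → w0 x = 1)
    (hG : eval w0 G ≠ 0) (hne : ∃ t, eval w0 (φ t) ≠ 0)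
    (hscal : ∀ (c : K) (w w' : τ → K), (∀ x, Lm x → w' x = c * w x) → (∀ x, ¬ Lm x → w' x = w x) →
      ∀ t, eval w' (φ t) = c * eval w (φ t)) :
    (((Fintype.card τ - 1 : ℕ) : ℕ∞) : WithBot ℕ∞) ≤
    Order.krullDim {Y : Set (PP K ι) // IsZClosed Y ∧ IsZIrreducible Y ∧ Y ⊆ Zpsi φ} := by
  classical
  have : Infinite K := IsAlgClosed.instInfinite
  let m := Fintype.card τ
  have hm : 0 < m := Fintype.card_pos_iff.mpr ⟨τ0⟩
  let e0 : τ ≃ Fin m := Fintype.equivFin τ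
  let e : τ ≃ Fin m := e0.trans (Equiv.swap (e0 τ0) ⟨0, hm⟩)
  have he : e τ0 = ⟨0, hm⟩ := by simp [e]
  let T : ℕ → Set τ := fun i => {x | (e x : ℕ) ≤ i}
  have hT0 : ∀ i, τ0 ∈ T i := fun i => by simp [T, he]
  let ψ : ∀ i : ℕ, ι → MvPolynomial (T i) K := fun i t => aeval (extp Lm τ0 w0 (T i) (hT0 i)) (φ t)
  have hψ : ∀ i w t, eval w (ψ i t) = eval (extw Lm τ0 w0 (T i) (hT0 i) w) (φ t) :=
    fun i w t => eval_extp _ _ _ _ _ _ _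
  have hres : ∀ i, extw Lm τ0 w0 (T i) (hT0 i) (fun x => w0 x) = w0 := by
    intro i
    funext x
    unfold extw
    split_ifs with h1 h2
    · rfl
    · change w0 τ0 = w0 x; rw [hw0 _ hτ0, hw0 _ h2]
    · rfl
  have hψne : ∀ i, ∃ t, ψ i t ≠ 0 := by
    intro i
    obtain ⟨t, ht⟩ := hne
    refine ⟨t, fun h => ht ?_⟩
    have := hψ i (fun x => w0 x) t
    rw [h, hres, map_zero] at this
    exact this.symm
  have hψs : ∀ i, Scal (ψ i) := by
    intro i c w
    refine ⟨fun x => if Lm x then c * w x else w x, fun t => ?_⟩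
    rw [hψ, hψ]
    refine hscal c _ _ ?_ ?_ t
    · intro x hx
      simp only [extw]
      split_ifs <;> first | rfl | simp_all
    · intro x hx
      simp only [extw]
      split_ifs <;> first | rfl | simp_all
  have hcard : ∀ i, i < m → Fintype.card (T i) = i + 1 := by
    intro i hi
    have e1 : T i ≃ {y : Fin m // y ≤ ⟨i, hi⟩} := e.subtypeEquiv (fun x => by simp [T, Fin.le_def])
    rw [Fintype.card_congr e1, Fintype.card_subtype]
    have : (Finset.univ.filter (fun y : Fin m => y ≤ ⟨i, hi⟩)) = Finset.Iic ⟨i, hi⟩ := by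
      ext; simp
    rw [this, Fin.card_Iic]
  have hrk : ∀ i, i < m →
      rk (RingHom.ker (aeval (ψ i) : MvPolynomial ι K →ₐ[K] MvPolynomial (T i) K)) = i + 1 := by
    intro i hi
    rw [← hcard i hi]
    refine rk_ker (ψ i) (aeval (extp Lm τ0 w0 (T i) (hT0 i)) G) ?_ ?_
    · intro h
      apply hG
      have := eval_extp Lm τ0 w0 (T i) (hT0 i) (fun x => w0 x) G
      rw [h, hres, map_zero] at this
      exact this.symm
    · intro v hv
      rw [eval_extp] at hv
      refine Set.Finite.of_injOn (f := extw Lm τ0 w0 (T i) (hT0 i)) ?_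
        (extw_inj Lm τ0 w0 (T i) (hT0 i)).injOn (hfin _ hv)
      rintro w ⟨h1, h2⟩
      rw [eval_extp] at h1
      refine ⟨h1, fun t => ?_⟩
      rw [← hψ, ← hψ]
      exact h2 t
  have hmono : ∀ i j, i ≤ j → ∀ f : MvPolynomial ι K, aeval (ψ j) f = 0 → aeval (ψ i) f = 0 := by
    intro i j hij f hf
    apply MvPolynomial.funext
    intro w
    have hs : T i ⊆ T j := fun x hx => le_trans hx hij
    have h1 := eval_aeval (ψ j) (fun x => extw Lm τ0 w0 (T i) (hT0 i) w x) f
    rw [eval_aeval]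
    simp only [hψ] at h1 ⊢
    rw [extw_trans Lm τ0 w0 (T i) (T j) _ _ hs, hf, map_zero] at h1
    rw [← h1, map_zero]
  have hsub : ∀ i, Zpsi (ψ i) ⊆ Zpsi φ := by
    rintro i x hx f ⟨hfh, hf⟩
    refine hx f ⟨hfh, ?_⟩
    apply MvPolynomial.funext
    intro w
    have h1 := eval_aeval φ (extw Lm τ0 w0 (T i) (hT0 i) w) f
    rw [eval_aeval]
    simp only [hψ]
    rw [← h1, hf, map_zero, map_zero]
  let F : Fin (m - 1 + 1) → {Y : Set (PP K ι) // IsZClosed Y ∧ IsZIrreducible Y ∧ Y ⊆ Zpsi φ} :=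
    fun i => ⟨Zpsi (ψ i), Zpsi_closed _, Zpsi_irred _ (hψne i), hsub i⟩
  have hF : StrictMono F := by
    intro i j hij
    have hij' : (i : ℕ) < j := hij
    change Zpsi (ψ i) < Zpsi (ψ j)
    refine lt_of_le_not_ge ?_ (fun hge => ?_)
    · rintro x hx f ⟨hfh, hf⟩
      exact hx f ⟨hfh, hmono i j hij'.le f hf⟩
    · have p1 : (RingHom.ker (aeval (ψ i) : MvPolynomial ι K →ₐ[K] MvPolynomial (T i) K)).IsPrime :=
        RingHom.ker_isPrime _
      have p2 : (RingHom.ker (aeval (ψ j) : MvPolynomial ι K →ₐ[K] MvPolynomial (T j) K)).IsPrime :=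
        RingHom.ker_isPrime _
      have hle := rk_le (RingHom.ker (aeval (ψ i) : MvPolynomial ι K →ₐ[K] MvPolynomial (T i) K))
        (RingHom.ker (aeval (ψ j) : MvPolynomial ι K →ₐ[K] MvPolynomial (T j) K)) (by
          intro f hf
          exact aeval_zero_of_vanish (ψ j) (hψne j) f
            (fun x hx v hv => ker_vanish (ψ i) (hψs i) f hf x (hge hx) v hv))
      rw [hrk i (by omega), hrk j (by omega)] at hle
      omega
  have := Order.LTSeries.length_le_krullDim (LTSeries.mk (m - 1) F hF)
  exact_mod_cast this

end

section
open MvPolynomial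

/-- polynomial parametrization -/
def phiP (K : Type*) [Field K] {s : ℕ} {n : Fin s → ℕ} (d : Fin s → ℕ) (k : ℕ)
    (t : svIndex s n d) : MvPolynomial (Fin k × Option (PX n)) K :=
  ∑ j, X (j, none) * nu d (hat 0 (fun x => X (j, some x))) t

lemma eval_phiP {K : Type*} [Field K] {s : ℕ} {n : Fin s → ℕ} (d : Fin s → ℕ) (k : ℕ)
    (w : Fin k × Option (PX n) → K) (t : svIndex s n d) :
    eval w (phiP K d k t) = phi d (fun j => w (j, none)) (fun j x => w (j, some x)) t := by
  simp only [phiP, phi, map_sum, map_mul, eval_X, Finset.sum_apply, Pi.smul_apply, smul_eq_mul]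
  refine Finset.sum_congr rfl (fun j _ => ?_)
  rw [eval_nu, eval_hat]
  simp only [eval_X]

lemma phi_scal {K : Type*} [Field K] {s : ℕ} {n : Fin s → ℕ} (d : Fin s → ℕ) (k : ℕ)
    (c : K) (w w' : Fin k × Option (PX n) → K)
    (h1 : ∀ x : Fin k × Option (PX n), x.2 = none → w' x = c * w x)
    (h2 : ∀ x : Fin k × Option (PX n), ¬ x.2 = none → w' x = w x) (t : svIndex s n d) :
    eval w' (phiP K d k t) = c * eval w (phiP K d k t) := by
  rw [eval_phiP, eval_phiP]
  have e1 : ∀ j, w' (j, none) = c * w (j, none) := fun j => h1 _ rfl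
  have e2 : ∀ j x, w' (j, some x) = w (j, some x) := fun j x => h2 _ (by simp)
  simp only [phi, e1, e2, Finset.sum_apply, Pi.smul_apply, smul_eq_mul, Finset.mul_sum, mul_assoc]

lemma phi_Scal {K : Type*} [Field K] {s : ℕ} {n : Fin s → ℕ} (d : Fin s → ℕ) (k : ℕ) :
    Scal (phiP (n := n) K d k) := by
  classical
  intro c w
  exact ⟨fun x => if x.2 = none then c * w x else w x,
    phi_scal d k c w _ (fun x hx => by simp [hx]) (fun x hx => by simp [hx])⟩

lemma phi_vanish {K : Type*} [Field K] [Infinite K] {s : ℕ} {n : Fin s → ℕ} (d : Fin s → ℕ) (k : ℕ)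
    (f : MvPolynomial (svIndex s n d) K) (hf : aeval (phiP K d k) f = 0)
    (μ : Fin k → K) (u : Fin k → ∀ i : Fin s, Fin (n i + 1) → K) :
    eval (∑ j, μ j • nu d (u j)) f = 0 := by
  let κ := Fin k × Option (Σ i : Fin s, Fin (n i + 1))
  let Φ : svIndex s n d → MvPolynomial κ K := fun t =>
    ∑ j, X (j, none) * nu d (fun i l => X (j, some ⟨i, l⟩)) t
  have hΦ : ∀ (w : κ → K), (fun t => eval w (Φ t)) =
      ∑ j, w (j, none) • nu d (fun i l => w (j, some ⟨i, l⟩)) := by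
    intro w
    funext t
    simp only [Φ, map_sum, map_mul, eval_X, Finset.sum_apply, Pi.smul_apply, smul_eq_mul]
    refine Finset.sum_congr rfl (fun j _ => ?_)
    rw [eval_nu]
    simp only [eval_X]
  have hz : aeval Φ f * ∏ j : Fin k, ∏ i : Fin s, (X (j, some ⟨i, 0⟩) : MvPolynomial κ K) = 0 := by
    apply MvPolynomial.funext
    intro w
    rw [map_mul, map_zero, eval_aeval, hΦ]
    by_cases hw : ∃ j i, w (j, some ⟨i, 0⟩) = 0
    · obtain ⟨j, i, h⟩ := hw
      refine mul_eq_zero_of_right _ ?_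
      rw [map_prod]
      refine Finset.prod_eq_zero (Finset.mem_univ j) ?_
      rw [map_prod]
      refine Finset.prod_eq_zero (Finset.mem_univ i) ?_
      rw [eval_X, h]
    · push Not at hw
      refine mul_eq_zero_of_left ?_ _
      choose y hy using fun j => eq_smul_hat (0 : ∀ i : Fin s, Fin (n i + 1))
        (fun i l => w (j, some ⟨i, l⟩)) (fun i => hw j i)
      let w' : Fin k × Option (PX n) → K := fun x => match x with
        | (j, none) => w (j, none) * ∏ i, w (j, some ⟨i, 0⟩) ^ d i
        | (j, some x) => y j x
      have : ∑ j, w (j, none) • nu d (fun i l => w (j, some ⟨i, l⟩)) =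
          fun t => eval w' (phiP K d k t) := by
        funext t
        rw [eval_phiP]
        refine congrFun ?_ t
        unfold phi
        refine Finset.sum_congr rfl (fun j _ => ?_)
        rw [hy j, nu_smul, smul_smul]
        rfl
      rw [this, ← eval_aeval, hf, map_zero]
  have hz' : aeval Φ f = 0 := by
    rcases mul_eq_zero.mp hz with h | h
    · exact h
    · exfalso
      rw [Finset.prod_eq_zero_iff] at h
      obtain ⟨j, -, h⟩ := h
      rw [Finset.prod_eq_zero_iff] at h
      obtain ⟨i, -, h⟩ := h
      exact X_ne_zero _ h
  let w : κ → K := fun x => match x with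
    | (j, none) => μ j
    | (j, some x) => u j x.1 x.2
  have := hΦ w
  have h2 : ∑ j, μ j • nu d (u j) = fun t => eval w (Φ t) := (hΦ w).symm
  rw [h2, ← eval_aeval, hz', map_zero]

lemma sec_sub {K : Type*} [Field K] [Infinite K] {s : ℕ} {n : Fin s → ℕ} (d : Fin s → ℕ) (k : ℕ)
    (S : Finset (PP K (svIndex s n d))) (hS : ↑S ⊆ segreVeroneseVariety K s n d) (hc : S.card = k)
    (q : PP K (svIndex s n d)) (hq : q ∈ projSpan (S : Set (PP K (svIndex s n d)))) :
    q ∈ Zpsi (phiP (n := n) K d k) := by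
  classical
  rintro f ⟨-, hf⟩ v hv
  have hv : v ∈ vspan (S : Set (PP K (svIndex s n d))) := hq hv
  choose r hr using fun x : S => hS x.2
  have hr' : ∀ x : S, x.1.submodule = Submodule.span K {nu d (r x)} := hr
  have hle : vspan (S : Set (PP K (svIndex s n d))) ≤
      Submodule.span K (Set.range (fun x : S => nu d (r x))) := by
    refine vspan_le (fun x hx => ?_)
    rw [hr' ⟨x, hx⟩]
    exact Submodule.span_mono (by rintro _ rfl; exact ⟨⟨x, hx⟩, rfl⟩)
  obtain ⟨g, hg⟩ := (Submodule.mem_span_range_iff_exists_fun K).mp (hle hv)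
  let e : Fin k ≃ S := (S.equivFinOfCardEq hc).symm
  rw [← hg, ← e.sum_comp]
  exact phi_vanish d k f hf (fun j => g (e j)) (fun j => r (e j))

lemma closed_sub {K : Type*} [Field K] {ι : Type*} {S : Set (PP K ι)} {Y : Set (PP K ι)}
    (hY : IsZClosed Y) (h : S ⊆ Y) : zclosure S ⊆ Y := Set.sInter_subset_of_mem ⟨hY, h⟩

lemma zclosure_closed {K : Type*} [Field K] {ι : Type*} {Y : Set (PP K ι)}
    (hY : IsZClosed Y) : zclosure Y = Y :=
  Set.Subset.antisymm (closed_sub hY le_rfl) (Set.subset_sInter fun _ h => h.2)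

lemma phi_ne_zero {K : Type*} [Field K] {s : ℕ} {n d b c : Fin s → ℕ}
    (hbc : ∀ i, d i = b i + c i) {k : ℕ} (hk : 1 ≤ k) (p : Fin k → PX n → K) (hp : GoodP b c p)
    (l : Fin k → K) (hl : ∀ j, l j ≠ 0) : phi d l p ≠ 0 := fun h =>
  hl ⟨0, hk⟩ (Fintype.linearIndependent_iff.mp (nud_indep hbc p hp) l h ⟨0, hk⟩)

lemma main_aux {K : Type*} [Field K] [IsAlgClosed K] {s : ℕ} (n d b c : Fin s → ℕ)
    (hd : ∀ i, 0 < d i) (hbc : ∀ i, d i = b i + c i) (k : ℕ) (hk : 1 ≤ k)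
    (G' : MvPolynomial (Fin k × PX n) K) (hG' : G' ≠ 0)
    (hgood : ∀ w, eval w G' ≠ 0 → GoodP b c (fun j x => w (j, x))) :
    zdim (secant k (segreVeroneseVariety K s n d)) =
      (((k * (∑ i, n i) + k - 1 : ℕ) : ℕ∞) : WithBot ℕ∞) ∧
    HoldsGenerically (secant k (segreVeroneseVariety K s n d)) fun q =>
      ∃! S : Finset (PP K (svIndex s n d)), S ∈ decompositions (segreVeroneseVariety K s n d) q := by
  classical
  have : Infinite K := IsAlgClosed.instInfinite
  let τ := Fin k × Option (PX n)
  let emb : Fin k × PX n → τ := fun x => (x.1, some x.2)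
  have hemb : Function.Injective emb := by
    rintro ⟨a, x⟩ ⟨b, y⟩ h
    obtain ⟨h1, h2⟩ := Prod.mk.inj h
    exact Prod.ext h1 (Option.some.inj h2)
  let φ : svIndex s n d → MvPolynomial τ K := phiP K d k
  let G : MvPolynomial τ K := (∏ j : Fin k, X (j, none)) * rename emb G'
  have hG : G ≠ 0 := by
    refine mul_ne_zero (Finset.prod_ne_zero_iff.mpr fun j _ => X_ne_zero _) ?_
    rw [Ne, ← map_zero (rename emb)]
    exact fun h => hG' (rename_injective emb hemb h)
  have hGe : ∀ w : τ → K, eval w G = (∏ j, w (j, none)) * eval (w ∘ emb) G' := by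
    intro w
    simp only [G, map_mul, map_prod, eval_X, eval_rename]
  have hGl : ∀ w : τ → K, eval w G ≠ 0 → ∀ j, w (j, none) ≠ 0 := by
    intro w hw j hj
    rw [hGe] at hw
    exact hw (mul_eq_zero_of_left (Finset.prod_eq_zero (Finset.mem_univ j) hj) _)
  have hGp : ∀ w : τ → K, eval w G ≠ 0 → GoodP b c (fun j x => w (j, some x)) := by
    intro w hw
    rw [hGe] at hw
    exact hgood (w ∘ emb) (right_ne_zero_of_mul hw)
  have hφe : ∀ w : τ → K, (fun t => eval w (φ t)) =
      phi d (fun j => w (j, none)) (fun j x => w (j, some x)) := fun w => funext (eval_phiP d k w)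
  have hfin : ∀ w0 : τ → K, eval w0 G ≠ 0 →
      {w : τ → K | eval w G ≠ 0 ∧ ∀ t, eval w (φ t) = eval w0 (φ t)}.Finite := by
    intro w0 h0
    refine Set.Finite.of_injOn (f := fun w : τ → K =>
      ((fun j => w (j, none), fun j x => w (j, some x)) : (Fin k → K) × (Fin k → PX n → K))) ?_ ?_
      (fiber_finite hd hbc _ (hGp w0 h0) _ (hGl w0 h0))
    · rintro w ⟨h1, h2⟩
      refine ⟨hGp w h1, ?_⟩
      change phi d (fun j => w (j, none)) (fun j x => w (j, some x)) = _
      rw [← hφe, ← hφe]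
      exact funext h2
    · rintro w - w' - h
      simp only [Prod.mk.injEq] at h
      funext ⟨j, o⟩
      cases o with
      | none => exact congrFun h.1 j
      | some x => exact congrFun (congrFun h.2 j) x
  obtain ⟨p0, hp0⟩ := exists_eval_ne G' hG'
  let w0 : τ → K := fun x => match x with
    | (_, none) => 1
    | (j, some x) => p0 (j, x)
  have hw0 : eval w0 G ≠ 0 := by
    rw [hGe]
    have : (w0 ∘ emb) = p0 := rfl
    rw [this]
    refine mul_ne_zero ?_ hp0
    exact Finset.prod_ne_zero_iff.mpr fun j _ => one_ne_zero
  have hne : ∀ w : τ → K, eval w G ≠ 0 → ∃ t, eval w (φ t) ≠ 0 := by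
    intro w hw
    by_contra hcon
    push Not at hcon
    refine phi_ne_zero hbc hk _ (hGp w hw) _ (hGl w hw) ?_
    rw [← hφe]
    exact funext hcon
  have hψ : ∃ t, φ t ≠ 0 := by
    obtain ⟨t, ht⟩ := hne w0 hw0
    exact ⟨t, fun h => ht (by rw [h, map_zero])⟩
  have hScal : Scal φ := phi_Scal d k
  have hsec : secant k (segreVeroneseVariety K s n d) = Zpsi φ := by
    apply Set.Subset.antisymm
    · refine closed_sub (Zpsi_closed φ) ?_
      rintro q ⟨S, hS, hc, hq⟩
      exact sec_sub d k S hS hc q hq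
    · refine Set.subset_sInter ?_
      rintro Y ⟨⟨S', hS', rfl⟩, hsub⟩ x hx f hf
      refine fun v hv => hx f ⟨hS' f hf, ?_⟩ v hv
      by_contra hcon
      obtain ⟨w, hw⟩ := exists_eval_ne (aeval φ f * G) (mul_ne_zero hcon hG)
      rw [map_mul] at hw
      have hwG := right_ne_zero_of_mul hw
      have hwf := left_ne_zero_of_mul hw
      have hnz := phi_ne_zero hbc hk _ (hGp w hwG) _ (hGl w hwG)
      obtain ⟨q, hq⟩ := exists_pt _ hnz
      have hmem := phi_mem d (fun j => w (j, none)) (fun j x => w (j, some x))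
      have hq' := hsub (a := q) ⟨decS d (fun j x => w (j, some x)), decS_sub d _,
        (dec_unique hd hbc _ (hGp w hwG) _ (hGl w hwG) _ (decS_sub d _) (decS_card_le d _) hmem).1, by
          change q.submodule ≤ _
          rw [hq, Submodule.span_singleton_le_iff_mem]
          exact hmem⟩
      apply hwf
      rw [eval_aeval, hφe]
      exact hq' f hf _ (by rw [hq]; exact Submodule.mem_span_singleton_self _)
  rw [hsec]
  constructor
  · have hcard : Fintype.card τ = k * (∑ i, n i) + k := by
      simp only [τ, Fintype.card_prod, Fintype.card_fin, Fintype.card_option, PX, Fintype.card_sigma]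
      ring
    unfold zdim
    rw [zclosure_closed (Zpsi_closed φ), ← hcard]
    refine le_antisymm ?_ ?_
    · exact krull_le φ hScal _ (rk_ker φ G hG hfin)
    · exact krull_ge φ G hfin (fun x => x.2 = none) (⟨0, hk⟩, none) rfl w0
        (by rintro ⟨j, o⟩ ho; cases o with
            | none => rfl
            | some x => simp at ho) hw0 (hne w0 hw0)
        (fun c w w' h1 h2 t => phi_scal d k c w w' h1 h2 t)
  · obtain ⟨h, hh, hlift⟩ := chevalley φ G hG
    have hex : ∃ e, aeval φ (homogeneousComponent e h) ≠ 0 := by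
      by_contra hcon
      push Not at hcon
      apply hh
      rw [← sum_homogeneousComponent h, map_sum]
      exact Finset.sum_eq_zero fun e _ => hcon e
    obtain ⟨e, he⟩ := hex
    have hhom : ∀ f ∈ ({homogeneousComponent e h} : Set (MvPolynomial (svIndex s n d) K)),
        ∃ d : ℕ, f.IsHomogeneous d := by
      rintro _ rfl
      exact ⟨e, homogeneousComponent_isHomogeneous e h⟩
    refine ⟨zeroLocus {homogeneousComponent e h}, ⟨_, hhom, rfl⟩, ?_, ?_⟩
    · intro hsub
      obtain ⟨w, hw, x, hx, hxs⟩ := exists_image φ hψ _ he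
      rw [eval_aeval] at hw
      exact hw (hsub hx _ rfl _ (by rw [hxs]; exact Submodule.mem_span_singleton_self _))
    · rintro x ⟨hx, hxY⟩
      have : ∃ v ∈ x.submodule, eval v (homogeneousComponent e h) ≠ 0 := by
        by_contra hcon
        push Not at hcon
        exact hxY (by rintro _ rfl v hv; exact hcon v hv)
      obtain ⟨v, hv, hve⟩ := this
      have : ∃ t : K, eval (t • v) h ≠ 0 := by
        by_contra hcon
        push Not at hcon
        exact hve (hc_vanish h v hcon e)
      obtain ⟨t, ht⟩ := this
      have htv := Submodule.smul_mem _ t hv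
      obtain ⟨w, hw, hwG⟩ := hlift (t • v) (fun f hf => ker_vanish φ hScal f hf x hx _ htv) ht
      have hnz := phi_ne_zero hbc hk _ (hGp w hwG) _ (hGl w hwG)
      have heq : phi d (fun j => w (j, none)) (fun j x => w (j, some x)) = t • v := by
        rw [← hφe]; exact funext hw
      refine unique_dec hd hbc _ (hGp w hwG) _ (hGl w hwG) x ?_
      rw [heq] at hnz ⊢
      rw [Projectivization.submodule_eq] at htv ⊢
      rw [Submodule.mem_span_singleton] at htv
      obtain ⟨a, ha⟩ := htv
      rw [← ha] at hnz ⊢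
      have ha0 : a ≠ 0 := by rintro rfl; exact hnz (zero_smul _ _)
      rw [Submodule.span_singleton_smul_eq (IsUnit.mk0 a ha0)]

end

/-- **Example (ii2).**  Fix `s ≥ 2`, `n i > 0`, `d i > 0`, and write
`d i = b i + c i` with `b i > 0`, `c i ≥ 0` and `c j > 0` for some `j`; set
`N = ∑ n i`.  Let `X ⊆ ℙ^r` be the Segre–Veronese embedding of
`ℙ^{n 1} × ⋯ × ℙ^{n s}` of multidegree `d`, over an algebraically closed field of
arbitrary characteristic.  If `k` is a positive integer with
`k ≤ min {-2 - N + ∏ C(n i + b i, n i), ∏ C(n i + c i, n i)}`, then `σ_k(X)` has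
dimension `kN + k - 1` and a general `q ∈ σ_k(X)` has a unique decomposition. -/
theorem statement19 {K : Type*} [Field K] [IsAlgClosed K]
    (s : ℕ) (hs : 2 ≤ s) (n d b c : Fin s → ℕ)
    (hn : ∀ i, 0 < n i) (hd : ∀ i, 0 < d i)
    (hb : ∀ i, 0 < b i) (hbc : ∀ i, d i = b i + c i) (hcj : ∃ j, 0 < c j)
    (N k : ℕ) (hN : N = ∑ i, n i) (hk : 1 ≤ k)
    (hk1 : k + N + 2 ≤ ∏ i, Nat.choose (n i + b i) (n i))
    (hk2 : k ≤ ∏ i, Nat.choose (n i + c i) (n i)) :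
    zdim (secant k (segreVeroneseVariety K s n d)) =
        (((k * N + k - 1 : ℕ) : ℕ∞) : WithBot ℕ∞) ∧
      HoldsGenerically (secant k (segreVeroneseVariety K s n d)) fun q =>
        ∃! S : Finset (PP K (svIndex s n d)), S ∈ decompositions (segreVeroneseVariety K s n d) q := by
  subst hN
  obtain ⟨G, hG, hgood⟩ := exists_goodP (K := K) hs n b c hn hb k hk hk1 hk2
  exact main_aux n d b c hd hbc k hk G hG hgood

end ContactLoci
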